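/- arXiv:2502.12077 — 9 statements merged into one kernel-verified Lean document; each statement's English description precedes it below -/
import Mathlib

section
/- Let G = (V,E) be a finite simple graph, let θ be a balanced load allocation of G, let t > 0, and set U = {x ∈ V : ∂θ(x) ≥ 1/t}. Then: (a) f_t(U) ≥ f_t(W) for every W ⊆ V; (b) every W ⊆ V with f_t(W) = f_t(U) satisfies W ⊆ U (so U is the maximizer of f_t of largest cardinality); (c) f_t(U ∪ W) ≥ f_t(W) for every W ⊆ V. -/
open scoped Classical

noncomputable section

/-- A load allocation of a simple graph `G`: a function `θ` assigning to each ordered pair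
`(x,y)` with `{x,y}` an edge a number in `[0,1]`, with `θ x y + θ y x = 1` on edges. -/
def IsLoadAllocation {V : Type*} (G : SimpleGraph V) (θ : V → V → ℝ) : Prop :=
  (∀ ⦃x y⦄, G.Adj x y → 0 ≤ θ x y ∧ θ x y ≤ 1) ∧
    ∀ ⦃x y⦄, G.Adj x y → θ x y + θ y x = 1

/-- The load of a vertex `x`: `∂θ(x) = Σ_{y ~ x} θ(y → x)`. -/
def load {V : Type*} [Fintype V] (G : SimpleGraph V) (θ : V → V → ℝ) (x : V) : ℝ :=
  ∑ y : V, if G.Adj x y then θ y x else 0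

/-- A load allocation is balanced if `∂θ(x) < ∂θ(y)` implies `θ(x → y) = 0` for edges `{x,y}`. -/
def IsBalanced {V : Type*} [Fintype V] (G : SimpleGraph V) (θ : V → V → ℝ) : Prop :=
  ∀ ⦃x y⦄, G.Adj x y → load G θ x < load G θ y → θ x y = 0

/-- The number of edges of `G` with both endpoints in `U`. -/
def edgesIn {V : Type*} (G : SimpleGraph V) (U : Set V) : ℕ :=
  {e ∈ G.edgeSet | ∀ v ∈ e, v ∈ U}.ncard

/-- `f_t(U) = t·|E(U)| − |U|`. -/
def fW {V : Type*} (G : SimpleGraph V) (t : ℝ) (U : Set V) : ℝ :=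
  t * (edgesIn G U) - U.ncard

/-- Flow along an ordered pair into its first vertex. -/
def flowIn {V : Type*} (G : SimpleGraph V) (θ : V → V → ℝ) (x y : V) : ℝ :=
  if G.Adj x y then θ y x else 0

/-- The edges inside `S`, as a graph. -/
def innerGraph {V : Type*} (G : SimpleGraph V) (S : Set V) : SimpleGraph V where
  Adj x y := G.Adj x y ∧ x ∈ S ∧ y ∈ S
  symm := ⟨fun _ _ h => ⟨h.1.symm, h.2.2, h.2.1⟩⟩
  loopless := ⟨fun _ h => G.irrefl h.1⟩

theorem flowIn_nonneg {V : Type*} (G : SimpleGraph V) (θ : V → V → ℝ)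
    (hθ : IsLoadAllocation G θ) (x y : V) : 0 ≤ flowIn G θ x y := by
  unfold flowIn
  split_ifs with h
  · exact (hθ.1 h.symm).1
  · exact le_rfl

theorem edgesIn_eq_sum {V : Type*} [Fintype V] (G : SimpleGraph V) (θ : V → V → ℝ)
    (hθ : IsLoadAllocation G θ) (S : Set V) :
    (edgesIn G S : ℝ) = ∑ x ∈ S.toFinset, ∑ y ∈ S.toFinset, flowIn G θ x y := by
  have h1 : edgesIn G S = (innerGraph G S).edgeFinset.card := by
    unfold edgesIn
    rw [← Set.ncard_coe_finset, SimpleGraph.coe_edgeFinset]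
    congr 1
    ext e
    induction e with
    | _ x y => simp [innerGraph]
  have h2 := (innerGraph G S).sum_degrees_eq_twice_card_edges
  have h3 : (∑ x, ((innerGraph G S).degree x : ℝ)) = 2 * (edgesIn G S : ℝ) := by
    rw [h1]; exact_mod_cast h2
  have h4 : (∑ x, ((innerGraph G S).degree x : ℝ))
      = ∑ x ∈ S.toFinset, ∑ y ∈ S.toFinset, (flowIn G θ x y + flowIn G θ y x) := by
    symm
    rw [← Finset.sum_subset (Finset.subset_univ S.toFinset)]
    · refine Finset.sum_congr rfl fun x hx => ?_
      have hx' : x ∈ S := by simpa using hx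
      rw [← SimpleGraph.card_neighborFinset_eq_degree, Finset.card_eq_sum_ones]
      push_cast
      have : (innerGraph G S).neighborFinset x = S.toFinset.filter (fun y => G.Adj x y) := by
        ext y
        rw [SimpleGraph.mem_neighborFinset]
        simp [innerGraph, hx', and_comm]
      rw [this, Finset.sum_filter]
      refine Finset.sum_congr rfl fun y _ => ?_
      unfold flowIn
      by_cases h : G.Adj x y
      · simp [h, h.symm, hθ.2 h.symm]
      · have h' : ¬ G.Adj y x := fun k => h k.symm
        simp [h, h']
    · intro x _ hx
      have hx' : x ∉ S := by simpa using hx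
      have : (innerGraph G S).degree x = 0 := by
        rw [← SimpleGraph.card_neighborFinset_eq_degree, Finset.card_eq_zero]
        ext y
        rw [SimpleGraph.mem_neighborFinset]
        simp [innerGraph, hx']
      simp [this]
  have h5 : ∑ x ∈ S.toFinset, ∑ y ∈ S.toFinset, flowIn G θ y x
      = ∑ x ∈ S.toFinset, ∑ y ∈ S.toFinset, flowIn G θ x y := Finset.sum_comm
  simp only [Finset.sum_add_distrib] at h4
  linarith

/-- Flow into `U` from outside of `U` vanishes. -/
theorem flowIn_eq_zero {V : Type*} [Fintype V] (G : SimpleGraph V) (θ : V → V → ℝ)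
    (hbal : IsBalanced G θ) (c : ℝ) {x y : V} (hx : c ≤ load G θ x) (hy : ¬ c ≤ load G θ y) :
    flowIn G θ x y = 0 := by
  unfold flowIn
  split_ifs with h
  · exact hbal h.symm (by linarith)
  · rfl

theorem load_eq_sum {V : Type*} [Fintype V] (G : SimpleGraph V) (θ : V → V → ℝ)
    (hbal : IsBalanced G θ) (c : ℝ) (S : Set V) (hS : {x | c ≤ load G θ x} ⊆ S)
    {x : V} (hx : c ≤ load G θ x) :
    ∑ y ∈ S.toFinset, flowIn G θ x y = load G θ x := by
  have : load G θ x = ∑ y, flowIn G θ x y := rfl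
  rw [this]
  refine Finset.sum_subset (Finset.subset_univ _) fun y _ hy => ?_
  refine flowIn_eq_zero G θ hbal c hx fun h => hy ?_
  simpa using hS h

theorem fW_le_sum {V : Type*} [Fintype V] (G : SimpleGraph V) (θ : V → V → ℝ)
    (hθ : IsLoadAllocation G θ) (t : ℝ) (ht : 0 < t) (W : Set V) :
    fW G t W ≤ ∑ x ∈ W.toFinset, (t * load G θ x - 1) := by
  unfold fW
  rw [edgesIn_eq_sum G θ hθ, Finset.sum_sub_distrib, ← Finset.mul_sum, Set.ncard_eq_toFinset_card']
  have : ∑ x ∈ W.toFinset, ∑ y ∈ W.toFinset, flowIn G θ x y ≤ ∑ x ∈ W.toFinset, load G θ x :=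
    Finset.sum_le_sum fun x _ => Finset.sum_le_sum_of_subset_of_nonneg (Finset.subset_univ _)
      fun y _ _ => flowIn_nonneg G θ hθ x y
  have := mul_le_mul_of_nonneg_left this ht.le
  simpa using this

theorem fW_eq_sum {V : Type*} [Fintype V] (G : SimpleGraph V) (θ : V → V → ℝ)
    (hθ : IsLoadAllocation G θ) (hbal : IsBalanced G θ) (t c : ℝ)
    (U : Set V) (hU : U = {x | c ≤ load G θ x}) :
    fW G t U = ∑ x ∈ U.toFinset, (t * load G θ x - 1) := by
  unfold fW
  rw [edgesIn_eq_sum G θ hθ, Finset.sum_sub_distrib, ← Finset.mul_sum, Set.ncard_eq_toFinset_card']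
  rw [Finset.sum_congr rfl fun x hx => load_eq_sum G θ hbal c U hU.ge
    (by rw [Set.mem_toFinset] at hx; exact hU.le hx)]
  simp

/-- Variational characterization of the balanced load: `U = {x : ∂θ(x) ≥ 1/t}` maximizes `f_t`,
it is the maximizer of largest cardinality, and `f_t(U ∪ W) ≥ f_t(W)` for every `W`. -/
theorem balanced_load_variational_characterization {V : Type*} [Fintype V]
    (G : SimpleGraph V) (θ : V → V → ℝ)
    (hθ : IsLoadAllocation G θ) (hbal : IsBalanced G θ) (t : ℝ) (ht : 0 < t) :
    (∀ W : Set V, fW G t W ≤ fW G t {x | 1 / t ≤ load G θ x}) ∧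
    (∀ W : Set V, fW G t W = fW G t {x | 1 / t ≤ load G θ x} →
      W ⊆ {x | 1 / t ≤ load G θ x}) ∧
    (∀ W : Set V, fW G t W ≤ fW G t ({x | 1 / t ≤ load G θ x} ∪ W)) := by
  have key : ∀ x, 1 / t ≤ load G θ x ↔ 0 ≤ t * load G θ x - 1 := by
    intro x
    rw [div_le_iff₀' ht, sub_nonneg]
  obtain ⟨U, hU⟩ : ∃ U : Set V, U = {x | 1 / t ≤ load G θ x} := ⟨_, rfl⟩
  have hmem : ∀ x, x ∈ U ↔ 1 / t ≤ load G θ x := fun x => by rw [hU]; rfl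
  rw [← hU]
  have hle : ∀ W : Set V, (∑ x ∈ W.toFinset, (t * load G θ x - 1))
      = (∑ x ∈ (W ∩ U).toFinset, (t * load G θ x - 1))
        + ∑ x ∈ (W \ U).toFinset, (t * load G θ x - 1) := by
    intro W
    rw [← Finset.sum_union]
    · congr 1
      ext x
      simp only [Set.mem_toFinset, Finset.mem_union, Set.mem_inter_iff, Set.mem_sdiff]
      tauto
    · rw [Finset.disjoint_left]
      intro x h1 h2
      rw [Set.mem_toFinset] at h1 h2
      exact h2.2 h1.2
  have hin : ∀ W : Set V, (∑ x ∈ (W ∩ U).toFinset, (t * load G θ x - 1)) ≤ fW G t U := by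
    intro W
    rw [fW_eq_sum G θ hθ hbal t _ U hU]
    refine Finset.sum_le_sum_of_subset_of_nonneg ?_ fun x hx _ => ?_
    · intro x hx
      rw [Set.mem_toFinset] at hx ⊢
      exact hx.2
    · rw [Set.mem_toFinset] at hx
      exact (key x).1 ((hmem x).1 hx)
  have hneg : ∀ W : Set V, ∀ x ∈ (W \ U).toFinset, t * load G θ x - 1 < 0 := by
    intro W x hx
    rw [Set.mem_toFinset] at hx
    by_contra h
    exact hx.2 ((hmem x).2 ((key x).2 (not_lt.1 h)))
  refine ⟨fun W => ?_, fun W hW x hx => ?_, fun W => ?_⟩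
  · have h1 := fW_le_sum G θ hθ t ht W
    have h2 := Finset.sum_nonpos fun x hx => (hneg W x hx).le
    linarith [hle W, hin W]
  · by_contra hxU
    have h1 := fW_le_sum G θ hθ t ht W
    have h2 := Finset.sum_neg (hneg W) ⟨x, by rw [Set.mem_toFinset]; exact ⟨hx, hxU⟩⟩
    linarith [hle W, hin W]
  · obtain ⟨S, hS⟩ : ∃ S : Set V, S = U ∪ W := ⟨_, rfl⟩
    rw [← hS]
    have hun : S.toFinset = W.toFinset ∪ (U \ W).toFinset := by
      ext x
      simp only [hS, Set.mem_toFinset, Finset.mem_union, Set.mem_union, Set.mem_sdiff]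
      tauto
    have hdis : Disjoint W.toFinset (U \ W).toFinset := by
      rw [Finset.disjoint_left]
      intro x h1 h2
      rw [Set.mem_toFinset] at h1 h2
      exact h2.2 h1
    have hcard : (S.ncard : ℝ) = W.ncard + ((U \ W).toFinset.card : ℝ) := by
      rw [Set.ncard_eq_toFinset_card', Set.ncard_eq_toFinset_card' W, hun,
        Finset.card_union_of_disjoint hdis]
      push_cast
      rfl
    have hsplit : ∀ f : V → ℝ, ∑ x ∈ S.toFinset, f x
        = ∑ x ∈ W.toFinset, f x + ∑ x ∈ (U \ W).toFinset, f x := by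
      intro f
      rw [hun, Finset.sum_union hdis]
    have hE : (edgesIn G W : ℝ) + ∑ x ∈ (U \ W).toFinset, load G θ x ≤ edgesIn G S := by
      rw [edgesIn_eq_sum G θ hθ, edgesIn_eq_sum G θ hθ S]
      rw [hsplit (fun x => ∑ y ∈ S.toFinset, flowIn G θ x y)]
      refine add_le_add ?_ (Finset.sum_le_sum fun x hx => ?_)
      · refine Finset.sum_le_sum fun x _ => Finset.sum_le_sum_of_subset_of_nonneg ?_
          fun y _ _ => flowIn_nonneg G θ hθ x y
        rw [hun]
        exact Finset.subset_union_left
      · rw [Set.mem_toFinset] at hx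
        exact (load_eq_sum G θ hbal (1 / t) S
          (by rw [hS, ← hU]; exact Set.subset_union_left) ((hmem x).1 hx.1)).ge
    have hs : 0 ≤ ∑ x ∈ (U \ W).toFinset, (t * load G θ x - 1) := by
      refine Finset.sum_nonneg fun x hx => ?_
      rw [Set.mem_toFinset] at hx
      exact (key x).1 ((hmem x).1 hx.1)
    rw [Finset.sum_sub_distrib, ← Finset.mul_sum] at hs
    simp only [Finset.sum_const, nsmul_eq_mul, mul_one] at hs
    have := mul_le_mul_of_nonneg_left hE ht.le
    unfold fW
    rw [hcard]
    linarith
end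
end

section
/- Let V be a finite set and let G1 = (V,E1) and G2 = (V,E2) be simple graphs with E1 ⊆ E2. Let θ1 be a balanced load allocation of G1 and θ2 a balanced load allocation of G2. Then ∂θ1(x) ≤ ∂θ2(x) for every x ∈ V. -/
open scoped Classical

noncomputable section

/-- Monotonicity of the balanced load: if `E1 ⊆ E2` then the balanced load of `G1` is
pointwise at most that of `G2`. -/
theorem balanced_load_monotone {V : Type*} [Fintype V]
    (G1 G2 : SimpleGraph V) (hle : G1 ≤ G2)
    (θ1 θ2 : V → V → ℝ)
    (h1 : IsLoadAllocation G1 θ1) (hb1 : IsBalanced G1 θ1)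
    (h2 : IsLoadAllocation G2 θ2) (hb2 : IsBalanced G2 θ2) :
    ∀ x : V, load G1 θ1 x ≤ load G2 θ2 x := by
  by_contra hcon
  push Not at hcon
  obtain ⟨x0, hx0⟩ := hcon
  set A : Finset V := Finset.univ.filter (fun x => load G2 θ2 x < load G1 θ1 x) with hA
  have memA : ∀ x, x ∈ A ↔ load G2 θ2 x < load G1 θ1 x := by intro x; simp [hA]
  let d : V → V → ℝ := fun x y =>
    (if G2.Adj x y then θ2 y x else 0) - (if G1.Adj x y then θ1 y x else 0)
  have hd : ∀ x, load G2 θ2 x - load G1 θ1 x = ∑ y, d x y := by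
    intro x
    simp only [load, d, Finset.sum_sub_distrib]
  have hneg : ∑ x ∈ A, ∑ y, d x y < 0 := by
    apply Finset.sum_neg
    · intro x hx
      rw [← hd]
      linarith [(memA x).1 hx]
    · exact ⟨x0, (memA x0).2 hx0⟩
  have hout : ∀ x ∈ A, ∀ y ∈ Aᶜ, 0 ≤ d x y := by
    intro x hx y hy
    rw [Finset.mem_compl, memA, not_lt] at hy
    rw [memA] at hx
    simp only [d]
    by_cases a1 : G1.Adj x y
    · have a2 := hle a1
      rw [if_pos a1, if_pos a2]
      by_cases hlt : load G1 θ1 y < load G1 θ1 x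
      · rw [hb1 a1.symm hlt]
        linarith [(h2.1 a2.symm).1]
      · have := hb2 a2 (by linarith)
        linarith [h2.2 a2, (h1.1 a1.symm).2]
    · rw [if_neg a1]
      split_ifs with a2
      · linarith [(h2.1 a2.symm).1]
      · simp
  have hin : ∀ x y, 0 ≤ d x y + d y x := by
    intro x y
    simp only [d, G1.adj_comm y x, G2.adj_comm y x]
    by_cases a1 : G1.Adj x y
    · have a2 := hle a1
      simp only [if_pos a1, if_pos a2]
      linarith [h1.2 a1, h2.2 a2]
    · simp only [if_neg a1]
      split_ifs with a2
      · linarith [h2.2 a2]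
      · simp
  have hAA : 0 ≤ ∑ x ∈ A, ∑ y ∈ A, d x y := by
    have e : ∑ x ∈ A, ∑ y ∈ A, d x y = ∑ x ∈ A, ∑ y ∈ A, d y x := Finset.sum_comm
    have p : 0 ≤ ∑ x ∈ A, ∑ y ∈ A, (d x y + d y x) :=
      Finset.sum_nonneg fun x _ => Finset.sum_nonneg fun y _ => hin x y
    simp only [Finset.sum_add_distrib] at p
    linarith
  have hAc : 0 ≤ ∑ x ∈ A, ∑ y ∈ Aᶜ, d x y :=
    Finset.sum_nonneg fun x hx => Finset.sum_nonneg fun y hy => hout x hx y hy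
  have hsplit : ∑ x ∈ A, ∑ y, d x y
      = ∑ x ∈ A, ∑ y ∈ A, d x y + ∑ x ∈ A, ∑ y ∈ Aᶜ, d x y := by
    rw [← Finset.sum_add_distrib]
    exact Finset.sum_congr rfl fun x _ => (Finset.sum_add_sum_compl A _).symm
  linarith
end
end

section
/- Let G = (V,E) be a finite simple graph and let θ be a balanced load allocation of G. Then for every vertex x ∈ V, one has ∂θ(x) < 1 if and only if the connected component of x in G is a tree (i.e., contains no cycle). In other words, the set of vertices with load less than 1 is exactly the union of the tree components of G. -/
open scoped Classical

noncomputable section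

/-- If no load enters `S` from outside, the total load of `S` is the number of edges in `S`. -/
theorem sum_load_eq_edges {V : Type*} [Fintype V] (G : SimpleGraph V) (θ : V → V → ℝ)
    (hθ : IsLoadAllocation G θ) (S : Set V) [Fintype S]
    (hS : ∀ u v, u ∉ S → v ∈ S → G.Adj u v → θ u v = 0) :
    ∑ v : S, load G θ v = (Nat.card (G.induce S).edgeSet : ℝ) := by
  have h1 : ∀ v : S, load G θ v = ∑ y : S, if G.Adj v y then θ y v else 0 := by
    intro v
    unfold load
    rw [← Finset.sum_subtype (Finset.univ.filter (· ∈ S)) (by simp)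
      (fun y : V => if G.Adj v y then θ y v else 0)]
    symm
    apply Finset.sum_subset (Finset.filter_subset _ _)
    intro y _ hy
    split_ifs with h
    · exact hS y v (by simpa using hy) v.2 h.symm
    · rfl
  have h2 : 2 * ∑ v : S, load G θ v = ∑ v : S, ((G.induce S).degree v : ℝ) := by
    simp_rw [h1]
    rw [two_mul]
    nth_rewrite 2 [Finset.sum_comm]
    rw [← Finset.sum_add_distrib]
    refine Finset.sum_congr rfl fun v _ => ?_
    rw [← Finset.sum_add_distrib, ← SimpleGraph.card_neighborFinset_eq_degree,
      SimpleGraph.neighborFinset_eq_filter, Finset.card_filter]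
    push_cast
    refine Finset.sum_congr rfl fun y _ => ?_
    by_cases h : G.Adj v y
    · simp [h, h.symm, hθ.2 h.symm]
    · have h' : ¬ G.Adj y v := fun h' => h h'.symm
      simp [h, h']
  have h3 := (G.induce S).sum_degrees_eq_twice_card_edges
  have h4 : ∑ v : S, ((G.induce S).degree v : ℝ) = 2 * ((G.induce S).edgeFinset.card : ℝ) := by
    exact_mod_cast h3
  rw [Nat.card_eq_fintype_card, ← SimpleGraph.edgeFinset_card]
  linarith

/-- A nonempty finite forest has fewer edges than vertices. -/
theorem forest_card_lt {V : Type*} [Fintype V] [Nonempty V] (G : SimpleGraph V)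
    (h : G.IsAcyclic) : Nat.card G.edgeSet + 1 ≤ Nat.card V := by
  obtain ⟨F, hF, -, hT⟩ :=
    (SimpleGraph.connected_top (V := V)).exists_isTree_le_of_le_of_isAcyclic le_top h
  rw [← (SimpleGraph.isTree_iff_connected_and_card.1 hT).2]
  have := Nat.card_mono (Set.toFinite F.edgeSet) (SimpleGraph.edgeSet_mono hF)
  omega

/-- The set of vertices with balanced load less than 1 is exactly the union of the tree
components: `∂θ(x) < 1` iff the connected component of `x` contains no cycle. -/
theorem balanced_load_lt_one_iff_tree_component {V : Type*} [Fintype V]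
    (G : SimpleGraph V) (θ : V → V → ℝ)
    (hθ : IsLoadAllocation G θ) (hbal : IsBalanced G θ) :
    ∀ x : V, load G θ x < 1 ↔
      ¬ ∃ y : V, G.Reachable x y ∧ ∃ w : G.Walk y y, w.IsCycle := by
  intro x
  constructor
  · rintro hx ⟨y, hxy, w, hw⟩
    -- vertices of load less than one form a union of components
    have hstep : ∀ u v, G.Adj u v → load G θ u < 1 → load G θ v < 1 := by
      intro u v huv hu
      by_contra hv
      have h0 := hbal huv (by linarith)
      have h1 : θ v u = 1 := by have := hθ.2 huv; linarith
      have h2 : θ v u ≤ load G θ u := by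
        unfold load
        have := Finset.single_le_sum (s := Finset.univ)
          (f := fun y => if G.Adj u y then θ y u else 0)
          (fun y _ => by
            split_ifs with h
            · exact (hθ.1 h.symm).1
            · exact le_rfl) (Finset.mem_univ v)
        simpa [huv] using this
      linarith
    have hreach : ∀ z, G.Reachable x z → load G θ z < 1 := by
      rintro z ⟨p⟩
      clear hxy
      induction p with
      | nil => exact hx
      | cons h p ih => exact ih (hstep _ _ h hx)
    let C := G.connectedComponentMk x
    have hC : ∀ z, z ∈ C.supp ↔ G.Reachable x z := by
      intro z
      rw [SimpleGraph.ConnectedComponent.mem_supp_iff, SimpleGraph.ConnectedComponent.eq]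
      exact ⟨fun h => h.symm, fun h => h.symm⟩
    have hsum := sum_load_eq_edges G θ hθ C.supp (by
      intro u v hu hv huv
      exact absurd ((hC u).2 (((hC v).1 hv).trans huv.symm.reachable)) hu)
    have hconn : (G.induce C.supp).Connected := C.connected_toSimpleGraph
    have hle := hconn.card_vert_le_card_edgeSet_add_one
    have hlt : ∑ v : C.supp, load G θ v < ∑ v : C.supp, (1 : ℝ) :=
      Finset.sum_lt_sum_of_nonempty ⟨⟨x, (hC x).2 (SimpleGraph.Reachable.refl x)⟩,
        Finset.mem_univ _⟩ (fun v _ => hreach v ((hC v).1 v.2))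
    rw [hsum, Finset.sum_const, Finset.card_univ, ← Nat.card_eq_fintype_card, nsmul_one] at hlt
    have hlt' : Nat.card (G.induce C.supp).edgeSet < Nat.card C.supp := by exact_mod_cast hlt
    have htree := SimpleGraph.isTree_iff_connected_and_card.2 ⟨hconn, by omega⟩
    have hsupp : ∀ z ∈ w.support, z ∈ C.supp := fun z hz =>
      (hC z).2 (hxy.trans (w.takeUntil z hz).reachable)
    apply htree.isAcyclic (w.induce C.supp hsupp)
    rw [← SimpleGraph.Walk.isCycle_map_iff_of_injective
      (f := (SimpleGraph.Embedding.induce C.supp).toHom) Subtype.val_injective,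
      SimpleGraph.Walk.map_induce]
    exact hw
  · intro hno
    by_contra hx
    let S : Set V := {v | G.Reachable x v ∧ 1 ≤ load G θ v}
    have hxS : x ∈ S := ⟨SimpleGraph.Reachable.refl x, not_lt.1 hx⟩
    have : Nonempty S := ⟨⟨x, hxS⟩⟩
    have hsum := sum_load_eq_edges G θ hθ S (by
      intro u v hu hv huv
      apply hbal huv
      by_contra hlt
      exact hu ⟨hv.1.trans huv.symm.reachable, hv.2.trans (not_lt.1 hlt)⟩)
    have hac : (G.induce S).IsAcyclic := by
      intro v p hp
      exact hno ⟨v, v.2.1, p.map (SimpleGraph.Embedding.induce S).toHom,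
        hp.map Subtype.val_injective⟩
    have hcard := forest_card_lt _ hac
    have hge : ∑ v : S, (1 : ℝ) ≤ ∑ v : S, load G θ v :=
      Finset.sum_le_sum fun v _ => v.2.2
    rw [hsum, Finset.sum_const, Finset.card_univ, ← Nat.card_eq_fintype_card, nsmul_one] at hge
    have hge' : Nat.card S ≤ Nat.card (G.induce S).edgeSet := by exact_mod_cast hge
    omega
end
end

section
/- Let G = (V,E) be a finite connected simple graph and let θ be a balanced load allocation of G. If |E| ≤ |V|, then ∂θ(x) ≤ 1 for every x ∈ V. If |E| > |V| (G is non-simple in the paper's terminology), then the set S = {x ∈ V : ∂θ(x) > 1} is the maximal 2-core of G: the subgraph of G induced on S has minimum degree at least 2, and every W ⊆ V whose induced subgraph has minimum degree at least 2 satisfies W ⊆ S. -/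
open scoped Classical

noncomputable section

/-- incoming weight at low vertices -/
def fl {V : Type*} [Fintype V] (G : SimpleGraph V) (θ : V → V → ℝ) (v y : V) : ℝ :=
  if load G θ v ≤ 1 then (if G.Adj v y then θ y v else 0) else 0

/-- parent indicator -/
def ind {V : Type*} [Fintype V] (G : SimpleGraph V) (θ : V → V → ℝ) (p : V → V) (v y : V) : ℝ :=
  if load G θ v ≤ 1 ∧ y = p v then 1 else 0

theorem fl_add {V : Type*} [Fintype V] (G : SimpleGraph V)
    (θ : V → V → ℝ) (hθ : IsLoadAllocation G θ) (hbal : IsBalanced G θ) {v y : V}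
    (h : G.Adj v y) (hv : load G θ v ≤ 1) : fl G θ v y + fl G θ y v = 1 := by
  have h1 := hθ.2 h
  by_cases hy : load G θ y ≤ 1
  · simp only [fl, hv, hy, h, h.symm, if_true]; linarith
  · have := hbal h (by linarith)
    simp only [fl, hv, hy, h, if_true, if_false]; linarith

theorem fl_nonneg {V : Type*} [Fintype V] (G : SimpleGraph V)
    (θ : V → V → ℝ) (hθ : IsLoadAllocation G θ) (v y : V) : 0 ≤ fl G θ v y := by
  unfold fl
  split_ifs with h1 h2
  · exact (hθ.1 h2.symm).1
  · exact le_rfl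
  · exact le_rfl

theorem ind_add_le {V : Type*} [Fintype V] (G : SimpleGraph V)
    (θ : V → V → ℝ) (hθ : IsLoadAllocation G θ) (hbal : IsBalanced G θ) (p : V → V) (d : V → ℕ)
    (hp : ∀ v, load G θ v ≤ 1 → G.Adj v (p v) ∧ d (p v) < d v) (v y : V) :
    ind G θ p v y + ind G θ p y v ≤ fl G θ v y + fl G θ y v := by
  have n1 := fl_nonneg G θ hθ v y
  have n2 := fl_nonneg G θ hθ y v
  by_cases h1 : load G θ v ≤ 1 ∧ y = p v
  · have a := hp v h1.1
    rw [← h1.2] at a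
    have h2 : ¬ (load G θ y ≤ 1 ∧ v = p y) := by
      intro h2
      have b := hp y h2.1
      rw [← h2.2] at b
      omega
    rw [fl_add G θ hθ hbal a.1 h1.1]
    simp only [ind, if_pos h1, if_neg h2]; norm_num
  · by_cases h2 : load G θ y ≤ 1 ∧ v = p y
    · have b := hp y h2.1
      rw [← h2.2] at b
      rw [add_comm (fl G θ v y), fl_add G θ hθ hbal b.1 h2.1]
      simp only [ind, if_pos h2, if_neg h1]; norm_num
    · simp only [ind, if_neg h2, if_neg h1]; linarith

theorem sum_fl {V : Type*} [Fintype V] (G : SimpleGraph V) (θ : V → V → ℝ) :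
    ∑ v, ∑ y, (fl G θ v y + fl G θ y v) = 2 * ∑ v, (if load G θ v ≤ 1 then load G θ v else 0) := by
  have h : ∑ v, ∑ y, fl G θ v y = ∑ v, (if load G θ v ≤ 1 then load G θ v else 0) := by
    refine Finset.sum_congr rfl fun v _ => ?_
    split_ifs with hv
    · simp only [fl, hv, if_true]; rfl
    · simp only [fl, hv, if_false, Finset.sum_const_zero]
  simp only [Finset.sum_add_distrib]
  rw [Finset.sum_comm (f := fun v y => fl G θ y v), h]; ring

theorem sum_ind {V : Type*} [Fintype V] (G : SimpleGraph V) (θ : V → V → ℝ) (p : V → V) :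
    ∑ v, ∑ y, (ind G θ p v y + ind G θ p y v) = 2 * ∑ v, (if load G θ v ≤ 1 then (1 : ℝ) else 0) := by
  have h : ∑ v, ∑ y, ind G θ p v y = ∑ v, (if load G θ v ≤ 1 then (1 : ℝ) else 0) := by
    refine Finset.sum_congr rfl fun v _ => ?_
    split_ifs with hv
    · simp [ind, hv]
    · simp [ind, hv]
  simp only [Finset.sum_add_distrib]
  rw [Finset.sum_comm (f := fun v y => ind G θ p y v), h]; ring

theorem sum_load {V : Type*} [Fintype V] (G : SimpleGraph V)
    (θ : V → V → ℝ) (hθ : IsLoadAllocation G θ) :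
    ∑ v, load G θ v = G.edgeSet.ncard := by
  have h1 : ∑ v, load G θ v = ∑ v, ∑ y, if G.Adj v y then θ v y else 0 := by
    unfold load
    rw [Finset.sum_comm]
    simp only [G.adj_comm]
  have h2 : (∑ v, load G θ v) + ∑ v, load G θ v = ∑ v, (G.degree v : ℝ) := by
    nth_rewrite 2 [h1]
    unfold load
    rw [← Finset.sum_add_distrib]
    refine Finset.sum_congr rfl fun v _ => ?_
    rw [← Finset.sum_add_distrib, ← G.card_neighborFinset_eq_degree, G.neighborFinset_eq_filter,
      Finset.card_filter]
    push_cast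
    refine Finset.sum_congr rfl fun y _ => ?_
    split_ifs with h
    · have := hθ.2 h; linarith
    · simp
  have h3 := G.sum_degrees_eq_twice_card_edges
  have h4 : G.edgeSet.ncard = G.edgeFinset.card := by
    rw [← SimpleGraph.coe_edgeFinset, Set.ncard_coe_finset]
  rw [h4]
  have h5 : (∑ v, (G.degree v : ℝ)) = 2 * (G.edgeFinset.card : ℝ) := by exact_mod_cast h3
  linarith

theorem exists_parent {V : Type*} (G : SimpleGraph V) (hconn : G.Connected) (s : V) :
    ∃ p : V → V, ∀ v, v ≠ s → G.Adj v (p v) ∧ G.dist (p v) s < G.dist v s := by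
  have : ∀ v, ∃ w, v ≠ s → G.Adj v w ∧ G.dist w s < G.dist v s := by
    intro v
    obtain ⟨q, hq⟩ := hconn.exists_walk_length_eq_dist v s
    cases q with
    | nil => exact ⟨s, fun h => absurd rfl h⟩
    | cons h q' =>
      rename_i w
      refine ⟨w, fun _ => ⟨h, ?_⟩⟩
      have := SimpleGraph.dist_le q'
      simp at hq
      omega
  choose p hp using this
  exact ⟨p, hp⟩

/-- For a finite connected graph: if `|E| ≤ |V|` then all balanced loads are at most 1;
if `|E| > |V|` then `S = {x : ∂θ(x) > 1}` is the maximal 2-core: the induced subgraph on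
`S` has minimum degree at least 2, and every `W` whose induced subgraph has minimum degree
at least 2 satisfies `W ⊆ S`. -/
theorem balanced_load_gt_one_iff_two_core {V : Type*} [Fintype V]
    (G : SimpleGraph V) (hconn : G.Connected)
    (θ : V → V → ℝ) (hθ : IsLoadAllocation G θ) (hbal : IsBalanced G θ) :
    (G.edgeSet.ncard ≤ Fintype.card V → ∀ x : V, load G θ x ≤ 1) ∧
    (Fintype.card V < G.edgeSet.ncard →
      (∀ x ∈ {x : V | 1 < load G θ x},
        2 ≤ ({y ∈ {x : V | 1 < load G θ x} | G.Adj x y}).ncard) ∧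
      (∀ W : Set V, (∀ x ∈ W, 2 ≤ ({y ∈ W | G.Adj x y}).ncard) →
        W ⊆ {x : V | 1 < load G θ x})) := by
  have key : ∀ s, 1 < load G θ s → ∃ p : V → V,
      (∀ v, load G θ v ≤ 1 → G.Adj v (p v) ∧ G.dist (p v) s < G.dist v s) := by
    intro s hs
    obtain ⟨p, hp⟩ := exists_parent G hconn s
    exact ⟨p, fun v hv => hp v (by rintro rfl; linarith)⟩
  have low : ∀ s, 1 < load G θ s → ∑ v, (if load G θ v ≤ 1 then (1 : ℝ) else 0) ≤
      ∑ v, (if load G θ v ≤ 1 then load G θ v else 0) := by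
    intro s hs
    obtain ⟨p, hp⟩ := key s hs
    have h := Finset.sum_le_sum fun v (_ : v ∈ Finset.univ) =>
      Finset.sum_le_sum fun y (_ : y ∈ Finset.univ) => ind_add_le G θ hθ hbal p (fun v => G.dist v s) hp v y
    rw [sum_ind, sum_fl] at h
    linarith
  have tot := sum_load G θ hθ
  refine ⟨?_, ?_⟩
  · intro hE x
    by_contra hx
    push Not at hx
    have hl := low x hx
    have h2 : ∑ v, (if load G θ v ≤ 1 then (0 : ℝ) else 1) <
        ∑ v, (if load G θ v ≤ 1 then 0 else load G θ v) := by
      refine Finset.sum_lt_sum (fun v _ => ?_) ⟨x, Finset.mem_univ _, ?_⟩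
      · split_ifs with h
        · exact le_rfl
        · linarith
      · rw [if_neg (by linarith), if_neg (by linarith)]; exact hx
    have h3 := add_lt_add_of_le_of_lt hl h2
    rw [← Finset.sum_add_distrib, ← Finset.sum_add_distrib] at h3
    have e1 : ∀ v, ((if load G θ v ≤ 1 then (1 : ℝ) else 0) +
      (if load G θ v ≤ 1 then (0 : ℝ) else 1)) = 1 := by intro v; split_ifs <;> simp
    have e2 : ∀ v, ((if load G θ v ≤ 1 then load G θ v else 0) +
      (if load G θ v ≤ 1 then 0 else load G θ v)) = load G θ v := by intro v; split_ifs <;> simp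
    simp only [e1, e2, tot] at h3
    simp at h3
    omega
  · intro hE
    have hex : ∃ s, 1 < load G θ s := by
      by_contra hn
      push Not at hn
      have := Finset.sum_le_sum fun v (_ : v ∈ Finset.univ) => hn v
      rw [tot] at this
      simp at this
      omega
    refine ⟨?_, ?_⟩
    · intro x hx
      have hx' : 1 < load G θ x := hx
      have hle : load G θ x ≤ (({y ∈ {x : V | 1 < load G θ x} | G.Adj x y}).ncard : ℝ) := by
        have e : ({y ∈ {x : V | 1 < load G θ x} | G.Adj x y}) =
            ((Finset.univ.filter fun y => 1 < load G θ y ∧ G.Adj x y : Finset V) : Set V) := by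
          ext y; simp
        rw [e, Set.ncard_coe_finset, Finset.card_filter]
        push_cast
        conv_lhs => unfold load
        refine Finset.sum_le_sum fun y _ => ?_
        by_cases h : G.Adj x y
        · by_cases hy : 1 < load G θ y
          · rw [if_pos h, if_pos ⟨hy, h⟩]; exact (hθ.1 h.symm).2
          · rw [if_pos h, hbal h.symm (by linarith)]; split_ifs <;> norm_num
        · simp [h]
      have : (1 : ℝ) < (({y ∈ {x : V | 1 < load G θ x} | G.Adj x y}).ncard : ℝ) :=
        lt_of_lt_of_le hx' hle
      exact_mod_cast this
    · intro W hW
      obtain ⟨s, hs⟩ := hex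
      obtain ⟨p, hp⟩ := key s hs
      have ub : ∑ v, (if load G θ v ≤ 1 then load G θ v else 0) ≤
          ∑ v, (if load G θ v ≤ 1 then (1 : ℝ) else 0) := by
        refine Finset.sum_le_sum fun v _ => ?_
        split_ifs with h
        · exact h
        · exact le_rfl
      have hle := ind_add_le G θ hθ hbal p (fun v => G.dist v s) hp
      have heq : ∑ v, ∑ y, (ind G θ p v y + ind G θ p y v) =
          ∑ v, ∑ y, (fl G θ v y + fl G θ y v) := by
        rw [sum_ind, sum_fl, le_antisymm ub (low s hs)]
      have htw : ∀ v y, ind G θ p v y + ind G θ p y v = fl G θ v y + fl G θ y v := by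
        intro v y
        have h1 := (Finset.sum_eq_sum_iff_of_le fun v _ =>
          Finset.sum_le_sum fun y _ => hle v y).1 heq v (Finset.mem_univ v)
        exact (Finset.sum_eq_sum_iff_of_le fun y _ => hle v y).1 h1 y (Finset.mem_univ y)
      by_contra hsub
      obtain ⟨u0, hu0W, hu0⟩ := Set.not_subset.1 hsub
      obtain ⟨u, hu, hmax⟩ := Finset.exists_max_image
        (Finset.univ.filter fun u => u ∈ W ∧ load G θ u ≤ 1) (fun u => G.dist u s)
        ⟨u0, by simpa using ⟨hu0W, by simpa using hu0⟩⟩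
      simp only [Finset.mem_filter, Finset.mem_univ, true_and] at hu hmax
      have hall : ∀ y ∈ W, G.Adj u y → y = p u := by
        intro y hy h
        by_contra hne
        have h1 := htw u y
        rw [fl_add G θ hθ hbal h hu.2] at h1
        by_cases h2 : load G θ y ≤ 1 ∧ u = p y
        · have b := (hp y h2.1).2
          rw [← h2.2] at b
          have := hmax y ⟨hy, h2.1⟩
          omega
        · simp [ind, hne, h2] at h1
      have h2 := hW u hu.1
      have h3 : ({y ∈ W | G.Adj u y}).ncard ≤ ({p u} : Set V).ncard :=
        Set.ncard_le_ncard (fun y hy => hall y hy.1 hy.2) (Set.finite_singleton _)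
      rw [Set.ncard_singleton] at h3
      omega
end
end

section
/- Fix λ > 0 and δ > 0. There exists a constant D = D(λ,δ) > 0 such that, with G ~ G(n, λ/n), the probability of the event {for every U ⊆ [n], the number of edges of G having at least one endpoint in U is at most D·|U| + δn/2} tends to 1 as n → ∞. -/
open scoped Classical

noncomputable section

/-- The index set of possible edges: unordered pairs of distinct elements of `Fin n`. -/
abbrev EdgeIdx (n : ℕ) := {e : Sym2 (Fin n) // ¬ e.IsDiag}

/-- Probability mass of a Bernoulli(q) outcome. -/
def bern (q : ℝ) (b : Bool) : ℝ := if b then q else 1 - q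

/-- Probability mass of a realization of the Erdős–Rényi graph G(n,q), encoded as the
indicator function of its edge set: each possible edge is present independently with
probability `q`. -/
def erMass (n : ℕ) (q : ℝ) (g : EdgeIdx n → Bool) : ℝ :=
  ∏ e : EdgeIdx n, bern q (g e)

/-- Probability of an event under G(n,q). -/
def erProb (n : ℕ) (q : ℝ) (E : Set (EdgeIdx n → Bool)) : ℝ :=
  ∑ g : EdgeIdx n → Bool, if g ∈ E then erMass n q g else 0

lemma er_sum_prod (n : ℕ) (f : EdgeIdx n → Bool → ℝ) :
    ∑ g : EdgeIdx n → Bool, ∏ e, f e (g e) = ∏ e, (f e true + f e false) := by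
  have h := Finset.prod_univ_sum (fun _ : EdgeIdx n => (Finset.univ : Finset Bool)) f
  rw [Fintype.piFinset_univ] at h
  rw [← h]
  refine Finset.prod_congr rfl fun e _ => ?_
  simp

lemma er_mass_nonneg (n : ℕ) (q : ℝ) (h0 : 0 ≤ q) (h1 : q ≤ 1) (g : EdgeIdx n → Bool) :
    0 ≤ erMass n q g := by
  refine Finset.prod_nonneg fun e _ => ?_
  unfold bern
  split_ifs <;> linarith

lemma er_mass_sum (n : ℕ) (q : ℝ) : ∑ g : EdgeIdx n → Bool, erMass n q g = 1 := by
  unfold erMass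
  rw [er_sum_prod n (fun _ b => bern q b)]
  simp [bern]

lemma er_touch_card (n : ℕ) (U : Set (Fin n)) :
    (Finset.univ.filter fun e : EdgeIdx n => ∃ v ∈ (e : Sym2 (Fin n)), v ∈ U).card
      ≤ n * U.ncard := by
  rw [← Finset.card_map (Function.Embedding.subtype _)]
  calc _ ≤ ((Finset.univ ×ˢ U.toFinset).image fun p : Fin n × Fin n => s(p.2, p.1)).card := by
        refine Finset.card_le_card fun e he => ?_
        simp only [Finset.mem_map, Finset.mem_filter, Finset.mem_univ, true_and] at he
        obtain ⟨e', ⟨v, hv, hU⟩, rfl⟩ := he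
        obtain ⟨w, hw⟩ := hv
        refine Finset.mem_image.2 ⟨(w, v), ?_, ?_⟩
        · simp [hU]
        · exact hw.symm
    _ ≤ _ := Finset.card_image_le
    _ = _ := by
        rw [Finset.card_product, Finset.card_univ, Fintype.card_fin, Set.ncard_eq_toFinset_card']

lemma er_exp (n : ℕ) (s : ℝ) (U : Set (Fin n)) (g : EdgeIdx n → Bool) :
    Real.exp (s * (({e : EdgeIdx n | g e = true ∧ ∃ v ∈ (e : Sym2 (Fin n)), v ∈ U}).ncard : ℝ))
      = ∏ e : EdgeIdx n,
        (if g e = true ∧ ∃ v ∈ (e : Sym2 (Fin n)), v ∈ U then Real.exp s else 1) := by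
  rw [Finset.prod_ite, Finset.prod_const, Finset.prod_const_one, mul_one, ← Real.exp_nat_mul,
    mul_comm, Set.ncard_eq_toFinset_card', Set.toFinset_setOf]

lemma er_mgf (n : ℕ) (q s : ℝ) (h0 : 0 ≤ q) (hs : 0 ≤ s) (U : Set (Fin n)) :
    ∑ g : EdgeIdx n → Bool, erMass n q g * Real.exp (s *
      (({e : EdgeIdx n | g e = true ∧ ∃ v ∈ (e : Sym2 (Fin n)), v ∈ U}).ncard : ℝ))
      ≤ Real.exp (q * (Real.exp s - 1) * (n * U.ncard)) := by
  have hE : 0 ≤ q * (Real.exp s - 1) :=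
    mul_nonneg h0 (by linarith [Real.add_one_le_exp s])
  simp_rw [er_exp, erMass, ← Finset.prod_mul_distrib]
  rw [er_sum_prod n (fun e b => bern q b *
    (if b = true ∧ ∃ v ∈ (e : Sym2 (Fin n)), v ∈ U then Real.exp s else 1))]
  calc _ ≤ ∏ e : EdgeIdx n, (if ∃ v ∈ (e : Sym2 (Fin n)), v ∈ U then
          Real.exp (q * (Real.exp s - 1)) else 1) := by
        refine Finset.prod_le_prod (fun e _ => ?_) (fun e _ => ?_)
        · by_cases h : ∃ v ∈ (e : Sym2 (Fin n)), v ∈ U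
          · simp only [h, bern]; simp; nlinarith
          · simp only [h, bern]; simp
        · by_cases h : ∃ v ∈ (e : Sym2 (Fin n)), v ∈ U
          · simp only [h, bern]; simp
            nlinarith [Real.add_one_le_exp (q * (Real.exp s - 1))]
          · simp only [h, bern]; simp
    _ = Real.exp (q * (Real.exp s - 1) * ((Finset.univ.filter fun e : EdgeIdx n =>
          ∃ v ∈ (e : Sym2 (Fin n)), v ∈ U).card : ℝ)) := by
        rw [Finset.prod_ite, Finset.prod_const, Finset.prod_const_one, mul_one,
          ← Real.exp_nat_mul, mul_comm]
    _ ≤ _ := by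
        have := er_touch_card n U
        have h2 : ((Finset.univ.filter fun e : EdgeIdx n =>
          ∃ v ∈ (e : Sym2 (Fin n)), v ∈ U).card : ℝ) ≤ n * U.ncard := by exact_mod_cast this
        exact Real.exp_le_exp.2 (mul_le_mul_of_nonneg_left h2 hE)

lemma er_prob_le (n : ℕ) (q : ℝ) (h0 : 0 ≤ q) (h1 : q ≤ 1) (E : Set (EdgeIdx n → Bool)) :
    erProb n q E ≤ 1 := by
  rw [← er_mass_sum n q]
  refine Finset.sum_le_sum fun g _ => ?_
  split_ifs
  · exact le_rfl
  · exact er_mass_nonneg n q h0 h1 g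

lemma er_lower (n : ℕ) (q s : ℝ) (h0 : 0 ≤ q) (h1 : q ≤ 1) (hs : 0 ≤ s)
    (t : Set (Fin n) → ℝ) :
    1 - ∑ U : Set (Fin n), Real.exp (q * (Real.exp s - 1) * (n * U.ncard) - s * t U) ≤
      erProb n q {g : EdgeIdx n → Bool | ∀ U : Set (Fin n),
          (({e : EdgeIdx n | g e = true ∧ ∃ v ∈ (e : Sym2 (Fin n)), v ∈ U}).ncard : ℝ)
            ≤ t U} := by
  have key : ∑ U : Set (Fin n), ∑ g : EdgeIdx n → Bool, erMass n q g * Real.exp (s *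
      (({e : EdgeIdx n | g e = true ∧ ∃ v ∈ (e : Sym2 (Fin n)), v ∈ U}).ncard : ℝ) - s * t U)
      ≤ ∑ U : Set (Fin n), Real.exp (q * (Real.exp s - 1) * (n * U.ncard) - s * t U) := by
    refine Finset.sum_le_sum fun U _ => ?_
    simp_rw [Real.exp_sub, ← mul_div_assoc, ← Finset.sum_div]
    exact div_le_div_of_nonneg_right (er_mgf n q s h0 hs U) (Real.exp_pos _).le
  rw [Finset.sum_comm] at key
  refine (sub_le_sub_left key 1).trans ?_
  rw [sub_le_iff_le_add, ← er_mass_sum n q, erProb, ← Finset.sum_add_distrib]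
  refine Finset.sum_le_sum fun g _ => ?_
  have hm := er_mass_nonneg n q h0 h1 g
  have hnn : ∀ U ∈ (Finset.univ : Finset (Set (Fin n))), 0 ≤ erMass n q g * Real.exp (s *
      (({e : EdgeIdx n | g e = true ∧ ∃ v ∈ (e : Sym2 (Fin n)), v ∈ U}).ncard : ℝ) - s * t U) :=
    fun U _ => mul_nonneg hm (Real.exp_pos _).le
  split_ifs with hg
  · exact le_add_of_nonneg_right (Finset.sum_nonneg hnn)
  · rw [Set.mem_setOf_eq] at hg
    push Not at hg
    obtain ⟨U, hU⟩ := hg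
    rw [zero_add]
    refine le_trans ?_ (Finset.single_le_sum hnn (Finset.mem_univ U))
    refine le_mul_of_one_le_right hm (Real.one_le_exp ?_)
    nlinarith

open Filter in
/-- Lemma 3.3 of the paper: for every `λ > 0` and `δ > 0` there is `D = D(λ,δ) > 0` so that,
with probability tending to 1 under G(n, λ/n), every vertex set `U` touches at most
`D·|U| + δn/2` edges. -/
theorem whp_edges_touching_set_linear (lam δ : ℝ) (hlam : 0 < lam) (hδ : 0 < δ) :
    ∃ D : ℝ, 0 < D ∧
      Tendsto (fun n : ℕ => erProb n (lam / n)
        {g : EdgeIdx n → Bool | ∀ U : Set (Fin n),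
          (({e : EdgeIdx n | g e = true ∧ ∃ v ∈ (e : Sym2 (Fin n)), v ∈ U}).ncard : ℝ)
            ≤ D * U.ncard + δ * n / 2})
        atTop (nhds 1) := by
  have hs : 0 < 2 / δ := by positivity
  have hE : 0 < Real.exp (2 / δ) - 1 := by linarith [Real.add_one_le_exp (2 / δ)]
  refine ⟨lam * (Real.exp (2 / δ) - 1) / (2 / δ), by positivity, ?_⟩
  have hlim : Tendsto (fun n : ℕ => 1 - (2 * Real.exp (-1)) ^ n) atTop (nhds 1) := by
    have h2 : 2 * Real.exp (-1) < 1 := by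
      rw [Real.exp_neg, ← div_eq_mul_inv, div_lt_one (Real.exp_pos _)]
      linarith [Real.exp_one_gt_d9]
    have := tendsto_pow_atTop_nhds_zero_of_lt_one (by positivity) h2
    simpa using this.const_sub 1
  have hev : ∀ᶠ n : ℕ in atTop, 0 < (n : ℝ) ∧ lam ≤ n := by
    filter_upwards [eventually_gt_atTop 0, eventually_ge_atTop ⌈lam⌉₊] with n h1 h2
    exact ⟨by exact_mod_cast h1, Nat.ceil_le.1 h2⟩
  refine tendsto_of_tendsto_of_tendsto_of_le_of_le' hlim tendsto_const_nhds ?_ ?_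
  · filter_upwards [hev] with n hn
    obtain ⟨hn0, hn1⟩ := hn
    refine le_trans (le_of_eq ?_) (er_lower n (lam / n) (2 / δ) (by positivity)
      ((div_le_one hn0).2 hn1) hs.le _)
    congr 1
    have : ∀ U : Set (Fin n), Real.exp (lam / n * (Real.exp (2 / δ) - 1) * (n * U.ncard) -
        2 / δ * (lam * (Real.exp (2 / δ) - 1) / (2 / δ) * U.ncard + δ * n / 2))
        = Real.exp (-1) ^ n := by
      intro U
      rw [← Real.exp_nat_mul]
      congr 1
      field_simp
      ring
    rw [Finset.sum_congr rfl fun U _ => this U, Finset.sum_const, Finset.card_univ,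
      Fintype.card_set, Fintype.card_fin, mul_pow, nsmul_eq_mul]
    push_cast
    rfl
  · filter_upwards [hev] with n hn
    exact er_prob_le n _ (by have := hn.1; positivity) ((div_le_one hn.1).2 hn.2) _
end
end

section
/- Fix α ∈ (0,1], ε > 0, ζ > 0, a positive integer N, and η with 0 < η < αεζ/8. Let L = ⌊(1−α)⁻¹⌋ if α < 1 and L = ⌈(2+2ε)/ε⌉ if α = 1; set α_t = (t−1)/t for 1 ≤ t ≤ L and α_{L+1} = min(α, L/(L+1)). Let l, u be real numbers with u ≥ α⁻¹ + ε and 0 ≤ u − l ≤ η, and set χ = N⁻¹η(αεζ/8 − η) > 0. Then for every real n > 0, every real T ≥ N⁻¹ηn, all reals n_1,…,n_L ≥ 0 with n_1 + ⋯ + n_L ≤ T and n_1 ≤ (1 − ζ/2)T, and all reals x_{−1}, x_0, x_1, …, x_{L+1} ≥ 0 satisfying Σ_{t=−1}^{L+1} x_t ≥ l·T and Σ_{t=1}^{j} x_t ≤ u·Σ_{t=1}^{j} n_t for every 1 ≤ j ≤ L, it holds that T − Σ_{t=1}^{L} n_t/t − x_{−1} − α·x_0 − Σ_{t=1}^{L}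 α_t·x_t − α_{L+1}·x_{L+1} ≤ −χ·n. -/
theorem aux_cast (f : ℤ → ℝ) (k : ℕ) :
    ∑ t ∈ Finset.Icc (1 : ℤ) (k : ℤ), f t = ∑ t ∈ Finset.Icc 1 k, f (t : ℤ) := by
  induction k with
  | zero => simp
  | succ k ih =>
    rw [Finset.sum_Icc_succ_top (by omega), ← ih]
    have : Finset.Icc (1 : ℤ) ((k + 1 : ℕ) : ℤ)
        = insert ((k + 1 : ℕ) : ℤ) (Finset.Icc (1 : ℤ) (k : ℤ)) := by
      ext a; simp only [Finset.mem_Icc, Finset.mem_insert]; omega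
    rw [this, Finset.sum_insert (by simp)]
    ring

theorem aux_split (f : ℤ → ℝ) (k : ℕ) :
    ∑ t ∈ Finset.Icc (-1 : ℤ) ((k : ℤ) + 1), f t
      = f (-1) + f 0 + ∑ t ∈ Finset.Icc 1 k, f (t : ℤ) + f ((k : ℤ) + 1) := by
  rw [← aux_cast]
  have : Finset.Icc (-1 : ℤ) ((k : ℤ) + 1)
      = insert (-1) (insert 0 (insert ((k : ℤ) + 1) (Finset.Icc (1 : ℤ) (k : ℤ)))) := by
    ext a; simp only [Finset.mem_Icc, Finset.mem_insert]; omega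
  rw [this, Finset.sum_insert (by simp; omega), Finset.sum_insert (by simp; omega),
    Finset.sum_insert (by simp)]
  ring

theorem aux_abel (β : ℝ) (d : ℕ → ℝ) (L : ℕ)
    (hd : ∀ j : ℕ, 1 ≤ j → j ≤ L → 0 ≤ ∑ t ∈ Finset.Icc 1 j, d t) (k : ℕ) (hk : 1 ≤ k) :
    k ≤ L → (β - ((k : ℝ) - 1) / k) * ∑ t ∈ Finset.Icc 1 k, d t
      ≤ ∑ t ∈ Finset.Icc 1 k, (β - ((t : ℝ) - 1) / t) * d t := by
  induction k, hk using Nat.le_induction with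
  | base => intro _; simp
  | succ k hk ih =>
    intro hkL
    have h1 := ih (by omega)
    have h2 := hd k hk (by omega)
    rw [Finset.sum_Icc_succ_top (by omega), Finset.sum_Icc_succ_top (by omega)]
    have hk0 : (0 : ℝ) < k := by exact_mod_cast hk
    have h3 : ((k : ℝ) - 1) / k ≤ (((k + 1 : ℕ) : ℝ) - 1) / ((k + 1 : ℕ) : ℝ) := by
      push_cast
      rw [div_le_div_iff₀ hk0 (by linarith)]
      nlinarith
    have h4 := mul_le_mul_of_nonneg_right h3 h2
    linarith

set_option maxHeartbeats 2000000 in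
/-- Lemma 2.9 of the paper (a purely algebraic inequality). With
`L = ⌊(1−α)⁻¹⌋ (α<1)` or `⌈(2+2ε)/ε⌉ (α=1)`, `α_t = (t−1)/t` for `1 ≤ t ≤ L`,
`α_{L+1} = min(α, L/(L+1))`, `u ≥ α⁻¹+ε`, `0 ≤ u−l ≤ η < αεζ/8` and
`χ = N⁻¹η(αεζ/8 − η)`, one has for `T ≥ N⁻¹ηn` and the constrained variables
`n_1,…,n_L, x_{-1},…,x_{L+1}`:
`T − Σ n_t/t − x_{−1} − α x_0 − Σ α_t x_t − α_{L+1} x_{L+1} ≤ −χn`. -/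
theorem algebraic_inequality
    (α ε ζ : ℝ) (hα1 : 0 < α) (hα2 : α ≤ 1) (hε : 0 < ε) (hζ : 0 < ζ)
    (N : ℕ) (hN : 0 < N) (η : ℝ) (hη1 : 0 < η) (hη2 : η < α * ε * ζ / 8)
    (L : ℕ) (hL : L = if α < 1 then ⌊(1 - α)⁻¹⌋₊ else ⌈(2 + 2 * ε) / ε⌉₊)
    (l u : ℝ) (hu : α⁻¹ + ε ≤ u) (hl1 : 0 ≤ u - l) (hl2 : u - l ≤ η)
    (n : ℝ) (hn : 0 < n) (T : ℝ) (hT : (N : ℝ)⁻¹ * η * n ≤ T)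
    (nn : ℕ → ℝ) (hnn : ∀ t, 0 ≤ nn t)
    (hsum : ∑ t ∈ Finset.Icc 1 L, nn t ≤ T)
    (hn1 : nn 1 ≤ (1 - ζ / 2) * T)
    (x : ℤ → ℝ) (hx : ∀ t ∈ Finset.Icc (-1 : ℤ) ((L : ℤ) + 1), 0 ≤ x t)
    (hxsum : l * T ≤ ∑ t ∈ Finset.Icc (-1 : ℤ) ((L : ℤ) + 1), x t)
    (hxpart : ∀ j : ℕ, 1 ≤ j → j ≤ L →
      ∑ t ∈ Finset.Icc (1 : ℤ) (j : ℤ), x t ≤ u * ∑ t ∈ Finset.Icc 1 j, nn t) :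
    T - (∑ t ∈ Finset.Icc 1 L, nn t / t)
      - x (-1) - α * x 0
      - (∑ t ∈ Finset.Icc (1 : ℤ) (L : ℤ), (((t : ℝ) - 1) / (t : ℝ)) * x t)
      - min α ((L : ℝ) / ((L : ℝ) + 1)) * x ((L : ℤ) + 1)
      ≤ -((N : ℝ)⁻¹ * η * (α * ε * ζ / 8 - η)) * n := by
  have hNpos : (0 : ℝ) < (N : ℝ)⁻¹ := by positivity
  have hTpos : 0 < T := lt_of_lt_of_le (by positivity) hT
  have hinv : 1 ≤ α⁻¹ := (one_le_inv₀ hα1).2 hα2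
  have hu1 : 1 + ε ≤ u := by linarith
  set β := min α ((L : ℝ) / ((L : ℝ) + 1)) with hβ
  -- the facts on `L` and `β`
  have key : 1 ≤ L ∧ ((L : ℝ) - 1) / L ≤ β ∧ α * ε / 4 ≤ u * β - 1 := by
    by_cases h : α < 1
    · rw [if_pos h] at hL
      have h1 : 0 < 1 - α := by linarith
      have hge : 1 ≤ (1 - α)⁻¹ := (one_le_inv₀ h1).2 (by linarith)
      have hL1 : 1 ≤ L := by
        rw [hL]; exact Nat.le_floor (by simpa using hge)
      have hLpos : (0 : ℝ) < L := by exact_mod_cast hL1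
      have hle : (L : ℝ) ≤ (1 - α)⁻¹ := by
        rw [hL]; exact Nat.floor_le (by linarith)
      have hlt : (1 - α)⁻¹ < (L : ℝ) + 1 := by
        rw [hL]; exact Nat.lt_floor_add_one _
      have hm : (1 - α)⁻¹ * (1 - α) = 1 := inv_mul_cancel₀ h1.ne'
      have hle' := mul_le_mul_of_nonneg_right hle h1.le
      have hlt' := mul_lt_mul_of_pos_right hlt h1
      have hβα : β = α := by
        apply min_eq_left
        rw [le_div_iff₀ (by linarith)]
        nlinarith
      refine ⟨hL1, ?_, ?_⟩
      · rw [hβα, div_le_iff₀ hLpos]; nlinarith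
      · rw [hβα]
        have := mul_le_mul_of_nonneg_right hu hα1.le
        rw [add_mul, inv_mul_cancel₀ hα1.ne'] at this
        nlinarith [mul_pos hα1 hε]
    · rw [if_neg h] at hL
      have hα : α = 1 := le_antisymm hα2 (not_lt.1 h)
      have hge : (2 + 2 * ε) / ε ≤ (L : ℝ) := by rw [hL]; exact Nat.le_ceil _
      have hge' : 2 + 2 * ε ≤ L * ε := (div_le_iff₀ hε).1 hge
      have hLpos : (0 : ℝ) < L := lt_of_lt_of_le (by positivity) hge
      have hβα : β = (L : ℝ) / ((L : ℝ) + 1) := by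
        apply min_eq_right
        rw [hα, div_le_one (by linarith)]; linarith
      refine ⟨by exact_mod_cast hLpos, ?_, ?_⟩
      · rw [hβα, div_le_div_iff₀ hLpos (by linarith)]; nlinarith
      · rw [hβα, hα]
        have hb : (0 : ℝ) ≤ (L : ℝ) / ((L : ℝ) + 1) := by positivity
        have h5 := mul_le_mul_of_nonneg_right hu1 hb
        have h6 : 1 + ε / 4 ≤ (1 + ε) * ((L : ℝ) / ((L : ℝ) + 1)) := by
          rw [← mul_div_assoc, le_div_iff₀ (by linarith)]
          nlinarith
        linarith
  obtain ⟨hL1, hβL, hc⟩ := key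
  have hβα : β ≤ α := min_le_left _ _
  have hβ0 : 0 ≤ β := le_min hα1.le (by positivity)
  have hαε : 0 < α * ε := mul_pos hα1 hε
  -- rewriting the integer sums
  rw [aux_split] at hxsum
  rw [aux_cast (fun t : ℤ => (((t : ℝ) - 1) / (t : ℝ)) * x t)]
  have hxm : 0 ≤ x (-1) := hx _ (by simp; omega)
  have hx0 : 0 ≤ x 0 := hx _ (by simp; omega)
  have hd : ∀ j : ℕ, 1 ≤ j → j ≤ L →
      0 ≤ ∑ t ∈ Finset.Icc 1 j, (u * nn t - x (t : ℤ)) := by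
    intro j h1 h2
    have := hxpart j h1 h2
    rw [aux_cast] at this
    rw [Finset.sum_sub_distrib, ← Finset.mul_sum]
    linarith
  have habel := aux_abel β _ L hd L hL1 le_rfl
  have habel0 := (mul_nonneg (sub_nonneg.2 hβL) (hd L hL1 le_rfl)).trans habel
  -- the bound on the `n`-part
  have hmono : ∑ t ∈ Finset.Icc 1 L, ((u - 1) / t - u * (1 - β)) * nn t
      ≤ ∑ t ∈ Finset.Icc 1 L,
        ((u * β - 1 - α * ε / 4) * nn t + if t = 1 then α * ε / 4 * nn 1 else 0) := by
    apply Finset.sum_le_sum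
    intro t ht
    rw [Finset.mem_Icc] at ht
    split_ifs with h
    · subst h; simp; nlinarith
    · have h2 : (2 : ℝ) ≤ t := by exact_mod_cast (by omega : 2 ≤ t)
      have h3 : (u - 1) / t ≤ (u - 1) / 2 :=
        div_le_div_of_nonneg_left (by linarith) (by norm_num) h2
      rw [add_zero]
      apply mul_le_mul_of_nonneg_right _ (hnn t)
      nlinarith
  rw [Finset.sum_add_distrib, ← Finset.mul_sum, Finset.sum_ite_eq' (Finset.Icc 1 L) 1,
    if_pos (by simp; omega)] at hmono
  have hA := mul_le_mul_of_nonneg_left hsum (sub_nonneg.2 hc)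
  have hB := mul_le_mul_of_nonneg_left hn1 (by positivity : 0 ≤ α * ε / 4)
  -- combine
  have hid : ∑ t ∈ Finset.Icc 1 L, (β - ((t : ℝ) - 1) / t) * (u * nn t - x (t : ℤ))
      = ∑ t ∈ Finset.Icc 1 L, ((u - 1) / t - u * (1 - β)) * nn t
        + ∑ t ∈ Finset.Icc 1 L, nn t / t
        - β * ∑ t ∈ Finset.Icc 1 L, x (t : ℤ)
        + ∑ t ∈ Finset.Icc 1 L, (((t : ℝ) - 1) / t) * x (t : ℤ) := by
    rw [Finset.mul_sum, ← Finset.sum_add_distrib, ← Finset.sum_sub_distrib,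
      ← Finset.sum_add_distrib]
    apply Finset.sum_congr rfl
    intro t ht
    rw [Finset.mem_Icc] at ht
    have : (t : ℝ) ≠ 0 := by exact_mod_cast (by omega : t ≠ 0)
    field_simp
    ring
  have hC := mul_le_mul_of_nonneg_left hxsum hβ0
  have hD : β * ((u - l) * T) ≤ η * T := by
    have h1 : (u - l) * T ≤ η * T := mul_le_mul_of_nonneg_right hl2 hTpos.le
    have h2 : 0 ≤ (u - l) * T := mul_nonneg hl1 hTpos.le
    exact (mul_le_of_le_one_left h2 (hβα.trans hα2)).trans h1
  have hE : β * x (-1) ≤ x (-1) := mul_le_of_le_one_left hxm (hβα.trans hα2)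
  have hF : β * x 0 ≤ α * x 0 := mul_le_mul_of_nonneg_right hβα hx0
  have hG := mul_le_mul_of_nonneg_left hT (sub_nonneg.2 hη2.le)
  simp only [Int.cast_natCast]
  rw [hid] at habel0
  linarith
end

section
/- Fix ε > 0, α ∈ (0,1], and a positive integer C. There exists N₀ such that for every n ≥ N₀ the following holds: if H is an admissible graph on [n] (with parameters C and D_n = (log n)^{1/(10C)}) and B ⊆ [n] satisfies |B| ≥ εn, then there exists a set A ⊆ B which is a good set of H and has |A| = K_n, where K_n = ⌈2n/(αε·√(log n))⌉. -/
open scoped Classical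

noncomputable section

/-- A graph `H` on `[n]` is admissible (with parameters `C` and `D_n = (log n)^{1/(10C)}`) if:
(i) all degrees are at most `log n`;
(ii) at least `(1 − e^{−D_n})·n` vertices have no vertex of degree `> D_n` within graph
distance `2C+2`;
(iii) every connected subgraph with fewer than `log log n` vertices contains at most one
cycle (equivalently, spans at most as many edges as vertices);
(iv) for every `k ≥ 3`, the number of cycles of length `k` is at most `(log n)^k`. -/
def Admissible (n C : ℕ) (H : SimpleGraph (Fin n)) : Prop :=
  (∀ v : Fin n, ((H.neighborSet v).ncard : ℝ) ≤ Real.log n) ∧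
  ((1 - Real.exp (-(Real.log n ^ ((1 : ℝ) / (10 * (C : ℝ)))))) * n ≤
    (({i : Fin n | ∀ j : Fin n, H.Reachable i j → H.dist i j ≤ 2 * C + 2 →
      ((H.neighborSet j).ncard : ℝ) ≤ Real.log n ^ ((1 : ℝ) / (10 * (C : ℝ)))}).ncard : ℝ)) ∧
  (∀ S : Set (Fin n), ((S.ncard : ℝ) < Real.log (Real.log n)) →
    (H.induce S).Connected →
    ({e ∈ H.edgeSet | ∀ v ∈ e, v ∈ S}).ncard ≤ S.ncard) ∧
  (∀ k : ℕ, 3 ≤ k →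
    (({Es : Set (Sym2 (Fin n)) | ∃ (v : Fin n) (w : H.Walk v v),
      w.IsCycle ∧ w.length = k ∧ Es = {e | e ∈ w.edges}}).ncard : ℝ) ≤ Real.log n ^ k)

/-- `A` is a good set of `H` (with parameter `C`): any two distinct vertices of `A` are at
graph distance greater than `2C+2`, and `A` is at distance greater than `C` from every cycle
of length at most `C`. -/
def GoodSet (n C : ℕ) (H : SimpleGraph (Fin n)) (A : Set (Fin n)) : Prop :=
  (∀ a ∈ A, ∀ b ∈ A, a ≠ b → ¬ (H.Reachable a b ∧ H.dist a b ≤ 2 * C + 2)) ∧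
  (∀ (v : Fin n) (w : H.Walk v v), w.IsCycle → w.length ≤ C →
    ∀ a ∈ A, ∀ x ∈ w.support, ¬ (H.Reachable a x ∧ H.dist a x ≤ C))


def gball {n : ℕ} (H : SimpleGraph (Fin n)) (v : Fin n) (r : ℕ) : Finset (Fin n) :=
  Finset.univ.filter fun u => H.Reachable v u ∧ H.dist v u ≤ r

lemma mem_gball {n : ℕ} {H : SimpleGraph (Fin n)} {v u : Fin n} {r : ℕ} :
    u ∈ gball H v r ↔ H.Reachable v u ∧ H.dist v u ≤ r := by
  simp [gball]

lemma real_card_biUnion_le {ι β : Type*} [DecidableEq β] (s : Finset ι) (f : ι → Finset β)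
    (m : ℝ) (h : ∀ i ∈ s, ((f i).card : ℝ) ≤ m) :
    ((s.biUnion f).card : ℝ) ≤ s.card * m := by
  calc ((s.biUnion f).card : ℝ) ≤ ((∑ i ∈ s, (f i).card : ℕ) : ℝ) := by
        exact_mod_cast Finset.card_biUnion_le
    _ = ∑ i ∈ s, ((f i).card : ℝ) := by push_cast; rfl
    _ ≤ ∑ i ∈ s, m := Finset.sum_le_sum h
    _ = s.card * m := by simp

lemma gball_succ_subset {n : ℕ} (H : SimpleGraph (Fin n)) (v : Fin n) (r : ℕ) :
    gball H v (r + 1) ⊆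
      (gball H v r).biUnion fun u => insert u (H.neighborSet u).toFinset := by
  intro x hx
  obtain ⟨hr, hd⟩ := mem_gball.1 hx
  rw [Finset.mem_biUnion]
  obtain ⟨w, hw⟩ := hr.exists_walk_length_eq_dist
  by_cases h0 : H.dist v x ≤ r
  · exact ⟨x, mem_gball.2 ⟨hr, h0⟩, by simp⟩
  · have hnn : ¬ w.Nil := by
      intro hn
      have := SimpleGraph.Walk.length_eq_zero_iff.2 hn
      omega
    refine ⟨w.penultimate, mem_gball.2 ⟨⟨w.dropLast⟩, ?_⟩, ?_⟩
    · have h1 := SimpleGraph.dist_le w.dropLast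
      have h2 : w.dropLast.length + 1 = w.length := by
        rw [← SimpleGraph.Walk.length_dropLast_add_one hnn]
      omega
    · simp [w.adj_penultimate hnn]

lemma gball_card {n : ℕ} (H : SimpleGraph (Fin n)) (v : Fin n) (r : ℕ) (d : ℝ) (hd : 0 ≤ d)
    (h : ∀ j ∈ gball H v r, ((H.neighborSet j).ncard : ℝ) ≤ d) :
    ((gball H v r).card : ℝ) ≤ (d + 1) ^ r := by
  induction r with
  | zero =>
    have : gball H v 0 ⊆ {v} := by
      intro x hx
      obtain ⟨hr, hd⟩ := mem_gball.1 hx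
      have := (hr.dist_eq_zero_iff).1 (by omega)
      simp [this]
    have := Finset.card_le_card this
    simp only [Finset.card_singleton] at this
    simpa using this
  | succ r ih =>
    have hs : gball H v r ⊆ gball H v (r + 1) := by
      intro x hx
      obtain ⟨hr, hd⟩ := mem_gball.1 hx
      exact mem_gball.2 ⟨hr, by omega⟩
    have ih' := ih fun j hj => h j (hs hj)
    calc ((gball H v (r + 1)).card : ℝ)
        ≤ (((gball H v r).biUnion fun u => insert u (H.neighborSet u).toFinset).card : ℝ) := by
          exact_mod_cast Finset.card_le_card (gball_succ_subset H v r)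
      _ ≤ (gball H v r).card * (d + 1) := by
          apply real_card_biUnion_le
          intro i hi
          have h1 := h i (hs hi)
          rw [Set.ncard_eq_toFinset_card'] at h1
          have h2 : ((insert i (H.neighborSet i).toFinset).card : ℝ)
              ≤ (H.neighborSet i).toFinset.card + 1 := by
            exact_mod_cast Finset.card_insert_le _ _
          linarith
      _ ≤ (d + 1) ^ r * (d + 1) := by gcongr
      _ = (d + 1) ^ (r + 1) := by ring

/-- vertices on cycles of length `k`. -/
def cycV {n : ℕ} (H : SimpleGraph (Fin n)) (k : ℕ) : Finset (Fin n) :=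
  Finset.univ.filter fun x => ∃ (v : Fin n) (w : H.Walk v v),
      w.IsCycle ∧ w.length = k ∧ x ∈ w.support

lemma cycV_card {n : ℕ} (H : SimpleGraph (Fin n)) (k : ℕ) (m : ℝ)
    (h : (({Es : Set (Sym2 (Fin n)) | ∃ (v : Fin n) (w : H.Walk v v),
      w.IsCycle ∧ w.length = k ∧ Es = {e | e ∈ w.edges}}).ncard : ℝ) ≤ m) :
    ((cycV H k).card : ℝ) ≤ m * (k + 1) := by
  set S := {Es : Set (Sym2 (Fin n)) | ∃ (v : Fin n) (w : H.Walk v v),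
      w.IsCycle ∧ w.length = k ∧ Es = {e | e ∈ w.edges}} with hS
  have hsub : cycV H k ⊆ S.toFinset.biUnion
      fun Es => Finset.univ.filter fun x => ∃ e ∈ Es, x ∈ e := by
    intro x hx
    obtain ⟨v, w, hc, hl, hx⟩ := (Finset.mem_filter.1 hx).2
    rw [Finset.mem_biUnion]
    refine ⟨{e | e ∈ w.edges}, by simpa [hS] using ⟨v, w, hc, hl, rfl⟩, ?_⟩
    simp only [Finset.mem_filter, Finset.mem_univ, true_and, Set.mem_ofPred_eq]
    exact (SimpleGraph.Walk.mem_support_iff_exists_mem_edges_of_not_nil hc.not_nil).1 hx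
  calc ((cycV H k).card : ℝ) ≤ ((S.toFinset.biUnion
      fun Es => Finset.univ.filter fun x => ∃ e ∈ Es, x ∈ e).card : ℝ) := by
        exact_mod_cast Finset.card_le_card hsub
    _ ≤ S.toFinset.card * ((k : ℝ) + 1) := by
      apply real_card_biUnion_le
      intro Es hEs
      obtain ⟨v, w, hc, hl, rfl⟩ := (Set.mem_toFinset.1 hEs)
      have : (Finset.univ.filter fun x => ∃ e ∈ {e | e ∈ w.edges}, x ∈ e)
          ⊆ w.support.toFinset := by
        intro x hx
        obtain ⟨e, he, hxe⟩ := (Finset.mem_filter.1 hx).2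
        exact List.mem_toFinset.2 (SimpleGraph.Walk.mem_support_of_mem_edges he hxe)
      have h1 := (Finset.card_le_card this).trans (List.toFinset_card_le _)
      rw [SimpleGraph.Walk.length_support, hl] at h1
      have h2 : (((Finset.univ.filter fun x => ∃ e ∈ {e | e ∈ w.edges}, x ∈ e).card : ℕ) : ℝ)
          ≤ k + 1 := by exact_mod_cast h1
      convert h2
    _ ≤ m * (k + 1) := by
      rw [Set.ncard_eq_toFinset_card'] at h
      gcongr

lemma greedy {n : ℕ} (H : SimpleGraph (Fin n)) (B : Finset (Fin n)) (r : ℕ) (M : ℝ)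
    (h : ∀ v ∈ B, ((gball H v r).card : ℝ) ≤ M) :
    ∃ A ⊆ B, (∀ a ∈ A, ∀ b ∈ A, a ≠ b → b ∉ gball H a r) ∧ (B.card : ℝ) ≤ A.card * M := by
  let F := B.powerset.filter fun A => ∀ a ∈ A, ∀ b ∈ A, a ≠ b → b ∉ gball H a r
  obtain ⟨A, hA, hmax⟩ := F.exists_max_image Finset.card ⟨∅, by simp [F]⟩
  simp only [F, Finset.mem_filter, Finset.mem_powerset] at hA hmax
  refine ⟨A, hA.1, hA.2, ?_⟩
  have hsymm : ∀ a b, b ∈ gball H a r → a ∈ gball H b r := by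
    intro a b hb
    obtain ⟨h1, h2⟩ := mem_gball.1 hb
    exact mem_gball.2 ⟨h1.symm, by rwa [SimpleGraph.dist_comm]⟩
  have hsub : B ⊆ A.biUnion fun a => gball H a r := by
    intro b hb
    rw [Finset.mem_biUnion]
    by_contra hcon
    push Not at hcon
    have hbA : b ∉ A := fun hbA => hcon b hbA (mem_gball.2 ⟨SimpleGraph.Reachable.refl _, by simp⟩)
    have := hmax (insert b A) ⟨Finset.insert_subset hb hA.1, by
      intro a ha c hc hac
      rcases Finset.mem_insert.1 ha with rfl | haA
      · rcases Finset.mem_insert.1 hc with rfl | hc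
        · exact absurd rfl hac
        · exact fun hh => hcon c hc (hsymm _ _ hh)
      · rcases Finset.mem_insert.1 hc with rfl | hc
        · exact hcon a haA
        · exact hA.2 a haA c hc hac⟩
    rw [Finset.card_insert_of_notMem hbA] at this
    omega
  calc (B.card : ℝ) ≤ ((A.biUnion fun a => gball H a r).card : ℝ) := by exact_mod_cast Finset.card_le_card hsub
    _ ≤ _ := real_card_biUnion_le _ _ _ fun a ha => h a (hA.1 ha)

open Filter Topology in
lemma asymp (ε α : ℝ) (hε : 0 < ε) (hα1 : 0 < α) (C : ℕ) (hC : 0 < C) :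
    ∀ᶠ n : ℕ in atTop, 1 ≤ Real.log n ∧
      Real.exp (-(Real.log n ^ ((1 : ℝ) / (10 * (C : ℝ))))) ≤ ε / 4 ∧
      (C : ℝ) * ((C + 1) * (2 * Real.log n) ^ (2 * C)) ≤ ε / 4 * n ∧
      (⌈2 * (n : ℝ) / (α * ε * Real.sqrt (Real.log n))⌉₊ : ℝ) *
        (2 ^ (2 * C + 2) * Real.log n ^ ((2 : ℝ) / 5)) ≤ ε / 2 * n := by
  have hlog : Tendsto (fun n : ℕ => Real.log n) atTop atTop :=
    Real.tendsto_log_atTop.comp tendsto_natCast_atTop_atTop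
  have e1 := hlog.eventually_ge_atTop 1
  have hCr : (0 : ℝ) < C := by exact_mod_cast hC
  have e2 : ∀ᶠ n : ℕ in atTop,
      Real.exp (-(Real.log n ^ ((1 : ℝ) / (10 * (C : ℝ))))) ≤ ε / 4 := by
    have h1 : Tendsto (fun n : ℕ => Real.log n ^ ((1 : ℝ) / (10 * (C : ℝ)))) atTop atTop :=
      (tendsto_rpow_atTop (by positivity)).comp hlog
    have h2 := Real.tendsto_exp_neg_atTop_nhds_zero.comp h1
    exact h2.eventually_le_const (by positivity)
  have pw : ∀ k : ℕ, ∀ c : ℝ, 0 < c → ∀ᶠ n : ℕ in atTop, c * Real.log n ^ k ≤ ε / 4 * n := by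
    intro k c hc
    have h1 := (isLittleO_log_rpow_rpow_atTop (k : ℝ) (zero_lt_one)).comp_tendsto
      (tendsto_natCast_atTop_atTop (R := ℝ))
    have h2 := h1.bound (c := ε / 4 / c) (by positivity)
    filter_upwards [h2, e1] with n h2 h3
    simp only [Function.comp, Real.rpow_natCast, Real.rpow_one, Real.norm_eq_abs,
      Nat.abs_cast] at h2
    rw [abs_of_nonneg (by positivity)] at h2
    calc c * Real.log n ^ k ≤ c * (ε / 4 / c * n) := by gcongr
      _ = ε / 4 * n := by field_simp
  have e3 := pw (2 * C) (C * ((C + 1) * 2 ^ (2 * C))) (by positivity)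
  have e4 := pw 1 (2 ^ (2 * C + 2)) (by positivity)
  have e5 : ∀ᶠ n : ℕ in atTop,
      Real.log n ^ (-((1 : ℝ) / 10)) ≤ ε / 4 * (α * ε / (2 * 2 ^ (2 * C + 2))) :=
    ((tendsto_rpow_neg_atTop (by norm_num : (0 : ℝ) < 1 / 10)).comp hlog).eventually_le_const
      (by positivity)
  filter_upwards [e1, e2, e3, e4, e5] with n h1 h2 h3 h4 h5
  refine ⟨h1, h2, ?_, ?_⟩
  · calc _ = (C * ((C + 1) * 2 ^ (2 * C))) * Real.log n ^ (2 * C) := by rw [mul_pow]; ring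
      _ ≤ _ := h3
  · set L := Real.log n with hL
    have hL0 : 0 < L := by linarith
    have hp : L ^ ((2 : ℝ) / 5) ≤ L := by
      calc L ^ ((2 : ℝ) / 5) ≤ L ^ (1 : ℝ) := Real.rpow_le_rpow_of_exponent_le h1 (by norm_num)
        _ = L := Real.rpow_one _
    have hq : L ^ ((2 : ℝ) / 5) = L ^ (-((1 : ℝ) / 10)) * Real.sqrt L := by
      rw [Real.sqrt_eq_rpow, ← Real.rpow_add hL0]; norm_num
    have hs : 0 < Real.sqrt L := Real.sqrt_pos.2 hL0
    have hce : (⌈2 * (n : ℝ) / (α * ε * Real.sqrt L)⌉₊ : ℝ)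
        ≤ 2 * (n : ℝ) / (α * ε * Real.sqrt L) + 1 := (Nat.ceil_lt_add_one (by positivity)).le
    calc _ ≤ (2 * (n : ℝ) / (α * ε * Real.sqrt L) + 1) *
          (2 ^ (2 * C + 2) * L ^ ((2 : ℝ) / 5)) := by gcongr
      _ = 2 * (n : ℝ) / (α * ε * Real.sqrt L) *
          (2 ^ (2 * C + 2) * (L ^ (-((1 : ℝ) / 10)) * Real.sqrt L))
          + 2 ^ (2 * C + 2) * L ^ ((2 : ℝ) / 5) := by rw [← hq]; ring
      _ = (2 * 2 ^ (2 * C + 2) / (α * ε)) * n * L ^ (-((1 : ℝ) / 10))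
          + 2 ^ (2 * C + 2) * L ^ ((2 : ℝ) / 5) := by
          congr 1; field_simp
      _ ≤ (2 * 2 ^ (2 * C + 2) / (α * ε)) * n * (ε / 4 * (α * ε / (2 * 2 ^ (2 * C + 2))))
          + 2 ^ (2 * C + 2) * L ^ 1 := by
          rw [pow_one L]; gcongr
      _ ≤ ε / 4 * n + ε / 4 * n := by
          refine add_le_add (le_of_eq ?_) h4
          field_simp
      _ = ε / 2 * n := by ring

/-- Lemma 4.4 of the paper: for large `n`, inside any admissible graph, every vertex set `B`
of size at least `εn` contains a good set of size exactly `K_n = ⌈2n/(αε√(log n))⌉`. -/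
theorem good_subset_of_admissible
    (ε α : ℝ) (hε : 0 < ε) (hα1 : 0 < α) (hα2 : α ≤ 1) (C : ℕ) (hC : 0 < C) :
    ∃ N₀ : ℕ, ∀ n : ℕ, N₀ ≤ n →
      ∀ H : SimpleGraph (Fin n), Admissible n C H →
        ∀ B : Set (Fin n), ε * n ≤ (B.ncard : ℝ) →
          ∃ A : Set (Fin n), A ⊆ B ∧ GoodSet n C H A ∧
            A.ncard = ⌈2 * (n : ℝ) / (α * ε * Real.sqrt (Real.log n))⌉₊ := by
  obtain ⟨N, hN⟩ := Filter.eventually_atTop.1 (asymp ε α hε hα1 C hC)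
  refine ⟨N, fun n hn H hH B hB => ?_⟩
  obtain ⟨hL1, hexp, hcyc, hceil⟩ := hN n hn
  obtain ⟨hi, hii, -, hiv⟩ := hH
  set K := ⌈2 * (n : ℝ) / (α * ε * Real.sqrt (Real.log n))⌉₊ with hK
  set L := Real.log n with hL
  have hCr : (1 : ℝ) ≤ C := by exact_mod_cast hC
  set D := L ^ ((1 : ℝ) / (10 * (C : ℝ))) with hD
  have hD1 : 1 ≤ D := Real.one_le_rpow hL1 (by positivity)
  set M := 2 ^ (2 * C + 2) * L ^ ((2 : ℝ) / 5) with hM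
  have hMpos : 0 < M := by positivity
  set I : Set (Fin n) := {i : Fin n | ∀ j : Fin n, H.Reachable i j → H.dist i j ≤ 2 * C + 2 →
      ((H.neighborSet j).ncard : ℝ) ≤ D} with hI
  have hball : ∀ v ∈ I, ((gball H v (2 * C + 2)).card : ℝ) ≤ M := by
    intro v hv
    calc ((gball H v (2 * C + 2)).card : ℝ) ≤ (D + 1) ^ (2 * C + 2) := by
          apply gball_card _ _ _ _ (by linarith)
          intro j hj
          obtain ⟨h1, h2⟩ := mem_gball.1 hj
          exact hv j h1 h2
      _ ≤ (2 * D) ^ (2 * C + 2) := by gcongr; linarith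
      _ = 2 ^ (2 * C + 2) * D ^ (2 * C + 2) := mul_pow _ _ _
      _ ≤ M := by
          rw [hM, hD, ← Real.rpow_natCast (L ^ _), ← Real.rpow_mul (by linarith)]
          gcongr
          push_cast
          rw [div_mul_eq_mul_div, div_le_div_iff₀ (by positivity) (by norm_num)]
          linarith
  -- bad vertices
  set Bad : Finset (Fin n) := (Finset.Icc 3 C).biUnion fun k =>
    (cycV H k).biUnion fun x => gball H x C with hBad
  have hBadcard : (Bad.card : ℝ) ≤ ε / 4 * n := by
    refine le_trans ?_ hcyc
    have h0 : ((Finset.Icc 3 C).card : ℝ) ≤ C := by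
      have : (Finset.Icc 3 C).card ≤ C := by rw [Nat.card_Icc]; omega
      exact_mod_cast this
    calc (Bad.card : ℝ) ≤ (Finset.Icc 3 C).card * ((C + 1) * (2 * L) ^ (2 * C)) := by
          apply real_card_biUnion_le
          intro k hk
          obtain ⟨hk3, hkC⟩ := Finset.mem_Icc.1 hk
          calc _ ≤ ((cycV H k).card : ℝ) * (L + 1) ^ C := by
                apply real_card_biUnion_le
                intro x _
                exact gball_card _ _ _ _ (by linarith) fun j _ => hi j
            _ ≤ (L ^ k * (k + 1)) * (L + 1) ^ C := by
                gcongr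
                exact cycV_card H k _ (hiv k hk3)
            _ ≤ ((2 * L) ^ C * (C + 1)) * (2 * L) ^ C := by
                have hkC' : (k : ℝ) ≤ C := by exact_mod_cast hkC
                have h5 : L ^ k ≤ (2 * L) ^ C :=
                  (pow_le_pow_right₀ hL1 hkC).trans (by gcongr; linarith)
                gcongr
                linarith
            _ = (C + 1) * (2 * L) ^ (2 * C) := by ring
      _ ≤ _ := by gcongr
  let B' : Finset (Fin n) := (B.toFinset \ Iᶜ.toFinset) \ Bad
  have hIc : ((Iᶜ.toFinset).card : ℝ) ≤ ε / 4 * n := by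
    have h1 : I.ncard + Iᶜ.ncard = n := by
      rw [Set.ncard_add_ncard_compl]; simp
    have h1' : (I.ncard : ℝ) + Iᶜ.ncard = n := by exact_mod_cast h1
    rw [← Set.ncard_eq_toFinset_card']
    have h3 : Real.exp (-D) * n ≤ ε / 4 * n := by gcongr
    linarith
  have hB' : ε / 2 * n ≤ (B'.card : ℝ) := by
    have h1 : B.toFinset.card ≤ B'.card + Bad.card + Iᶜ.toFinset.card := by
      have a1 := Finset.le_card_sdiff Bad (B.toFinset \ Iᶜ.toFinset)
      have a2 := Finset.le_card_sdiff Iᶜ.toFinset B.toFinset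
      simp only [B']
      omega
    have h1' : (B.toFinset.card : ℝ) ≤ B'.card + Bad.card + Iᶜ.toFinset.card := by
      exact_mod_cast h1
    rw [Set.ncard_eq_toFinset_card'] at hB
    linarith
  have hmem : ∀ b ∈ B', b ∈ B ∧ b ∈ I ∧ b ∉ Bad := by
    intro b hb
    simpa only [B', Finset.mem_sdiff, Set.mem_toFinset, Set.mem_compl_iff, not_not,
      and_assoc] using hb
  obtain ⟨A, hAB, hsep, hcard⟩ := greedy H B' (2 * C + 2) M fun v hv => hball v (hmem v hv).2.1
  have hKA : K ≤ A.card := by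
    have : (K : ℝ) * M ≤ A.card * M := hceil.trans (hB'.trans hcard)
    exact_mod_cast le_of_mul_le_mul_right this hMpos
  obtain ⟨A', hA', hA'c⟩ := Finset.exists_subset_card_eq hKA
  refine ⟨(A' : Set (Fin n)), fun a ha => (hmem a (hAB (hA' ha))).1, ⟨?_, ?_⟩, ?_⟩
  · intro a ha b hb hab hh
    exact hsep a (hA' ha) b (hA' hb) hab (mem_gball.2 hh)
  · intro v w hw hwl a ha x hx hh
    apply (hmem a (hAB (hA' ha))).2.2
    rw [hBad, Finset.mem_biUnion]
    refine ⟨w.length, Finset.mem_Icc.2 ⟨hw.three_le_length, hwl⟩, ?_⟩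
    rw [Finset.mem_biUnion]
    refine ⟨x, by simpa [cycV] using ⟨v, w, hw, rfl, hx⟩, mem_gball.2 ⟨hh.1.symm, ?_⟩⟩
    rw [SimpleGraph.dist_comm]; exact hh.2
  · rw [Set.ncard_coe_finset, hA'c]
end
end

section
/- Fix p ∈ (0,1), s ∈ (0,1), an integer k ≥ 1, and θ ≥ 0; let ν = e^{θ} − 1. Let I_0, …, I_{k−1} be i.i.d. Bernoulli random variables with mean p, set I_k = I_0, and let J¹_0, …, J¹_{k−1}, J²_1, …, J²_k be i.i.d. Bernoulli random variables with mean s, all independent of each other and of the I's. Define X_k = Σ_{t=1}^{k} I_{t−1}·J¹_{t−1}·I_t·J²_t. The quadratic x² − (1 + ps²ν)x + p(1−p)s²ν has two real nonnegative roots μ₁ ≥ μ₂ ≥ 0, and E[exp(θ·X_k)] = μ₁^k + μ₂^k. -/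
open scoped Classical

noncomputable section

/-- Sample space for the cycle variables: the indicator families
`I_0,…,I_{k−1}` (with the convention `I_k = I_0`), `J¹_0,…,J¹_{k−1}` and
(reindexed) `J²_1,…,J²_k`. -/
abbrev CycOmega (k : ℕ) := (Fin k → Bool) × (Fin k → Bool) × (Fin k → Bool)

/-- The joint probability mass: all indicators are independent, the `I`'s are Bernoulli(p)
and the `J`'s are Bernoulli(s). -/
def cycMass (k : ℕ) (p s : ℝ) (ω : CycOmega k) : ℝ :=
  (∏ i : Fin k, bern p (ω.1 i)) * (∏ i : Fin k, bern s (ω.2.1 i)) *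
    (∏ i : Fin k, bern s (ω.2.2 i))

/-- `X_k = Σ_{t=1}^{k} I_{t−1}·J¹_{t−1}·I_t·J²_t` with `I_k = I_0` (addition in `Fin k`
wraps around, realizing the cyclic convention). -/
def Xk (k : ℕ) (ω : CycOmega k) : ℕ :=
  (Finset.univ.filter
    (fun t : Fin k => ω.1 t = true ∧ ω.2.1 t = true ∧ ω.1 ⟨(t.val + 1) % k, Nat.mod_lt _ t.pos⟩ = true ∧ ω.2.2 t = true)).card

/-- transfer matrix -/
def cycM (p c : ℝ) : Matrix Bool Bool ℝ :=
  fun a b => bern p a * (if a = true ∧ b = true then 1 + c else 1)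

theorem path_sum (M : Matrix Bool Bool ℝ) (n : ℕ) : ∀ h : Bool → Bool → ℝ,
    ∑ f : Fin (n + 1) → Bool, (∏ t : Fin n, M (f t.castSucc) (f t.succ)) * h (f 0) (f (Fin.last n))
      = ∑ a, ∑ b, (M ^ n) a b * h a b := by
  induction n with
  | zero =>
    intro h
    rw [← (Equiv.funUnique (Fin 1) Bool).symm.sum_comp]
    simp [Matrix.one_apply]
  | succ n ih =>
    intro h
    rw [← (Fin.consEquiv (fun _ : Fin (n + 2) => Bool)).sum_comp, Fintype.sum_prod_type,
      Finset.sum_comm]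
    have h1 := ih (fun c d => ∑ a, M a c * h a d)
    have h2 : ∀ f : Fin (n + 1) → Bool,
        ∑ a : Bool, (∏ t : Fin (n + 1),
          M ((Fin.consEquiv (fun _ : Fin (n + 2) => Bool)) (a, f) t.castSucc)
            ((Fin.consEquiv (fun _ : Fin (n + 2) => Bool)) (a, f) t.succ)) *
          h ((Fin.consEquiv (fun _ : Fin (n + 2) => Bool)) (a, f) 0)
            ((Fin.consEquiv (fun _ : Fin (n + 2) => Bool)) (a, f) (Fin.last (n + 1)))
        = (∏ t : Fin n, M (f t.castSucc) (f t.succ)) *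
            ∑ a, M a (f 0) * h a (f (Fin.last n)) := by
      intro f
      rw [Finset.mul_sum]
      refine Finset.sum_congr rfl fun a _ => ?_
      rw [Fin.prod_univ_succ]
      simp only [Fin.consEquiv_apply, Fin.cons_succ, Fin.castSucc_zero, Fin.cons_zero,
        ← Fin.succ_castSucc, ← Fin.succ_last]
      ring
    rw [Finset.sum_congr rfl fun f _ => h2 f, h1]
    simp only [pow_succ' M n, Matrix.mul_apply, Fintype.sum_bool]
    ring

theorem cyc_sum (M : Matrix Bool Bool ℝ) (k : ℕ) (hk : 1 ≤ k) :
    ∑ f : Fin k → Bool, ∏ t : Fin k, M (f t) (f ⟨(t.val + 1) % k, Nat.mod_lt _ t.pos⟩)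
      = (M ^ k).trace := by
  obtain ⟨n, rfl⟩ : ∃ n, k = n + 1 := ⟨k - 1, by omega⟩
  have h := path_sum M n (fun a b => M b a)
  have h2 : (M ^ (n + 1)).trace = ∑ a, ∑ b, (M ^ n) a b * M b a := by
    simp [pow_succ, Matrix.trace, Matrix.mul_apply]
  rw [h2, ← h]
  refine Finset.sum_congr rfl fun f _ => ?_
  rw [Fin.prod_univ_castSucc]
  congr 1
  · refine Finset.prod_congr rfl fun t _ => ?_
    congr 2
    ext
    simp [Nat.mod_eq_of_lt]
  · congr 2
    ext
    simp

theorem trace_pow (M : Matrix Bool Bool ℝ) (x y : ℝ) (h1 : x + y = M.trace)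
    (h2 : x * y = M true true * M false false - M true false * M false true) (n : ℕ) :
    (M ^ n).trace = x ^ n + y ^ n := by
  have hM : M * M = (x + y) • M - (x * y) • (1 : Matrix Bool Bool ℝ) := by
    rw [h1, h2]
    ext a b
    cases a <;> cases b <;> simp [Matrix.mul_apply, Matrix.trace] <;> ring
  induction n using Nat.twoStepInduction with
  | zero => simp; norm_num
  | one => simp [h1]
  | more n ih1 ih2 =>
    have : M ^ (n + 2) = (x + y) • M ^ (n + 1) - (x * y) • M ^ n := by
      rw [pow_add, pow_two, hM, mul_sub, pow_succ]
      simp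
    rw [this, Matrix.trace_sub, Matrix.trace_smul, Matrix.trace_smul, ih1, ih2]
    simp only [smul_eq_mul]
    ring

theorem sum_fun_prod (k : ℕ) (g : Fin k → Bool → ℝ) :
    ∑ f : Fin k → Bool, ∏ t, g t (f t) = ∏ t, ∑ b, g t b := by
  rw [Finset.prod_univ_sum, Fintype.piFinset_univ]

theorem moment_eq (p s θ : ℝ) (k : ℕ) (hk : 1 ≤ k) :
    (∑ ω : CycOmega k, cycMass k p s ω * Real.exp (θ * (Xk k ω)))
      = ((cycM p (s ^ 2 * (Real.exp θ - 1))) ^ k).trace := by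
  rw [← cyc_sum _ k hk, Fintype.sum_prod_type]
  refine Finset.sum_congr rfl fun f _ => ?_
  rw [Fintype.sum_prod_type]
  set nx : Fin k → Fin k := fun t => ⟨(t.val + 1) % k, Nat.mod_lt _ t.pos⟩ with hnx
  have key : ∀ u v : Fin k → Bool,
      cycMass k p s (f, u, v) * Real.exp (θ * (Xk k (f, u, v))) =
      ∏ t, (bern p (f t) * bern s (u t) * bern s (v t) *
        (if f t = true ∧ u t = true ∧ f (nx t) = true ∧ v t = true then Real.exp θ else 1)) := by
    intro u v
    rw [Finset.prod_mul_distrib, Finset.prod_mul_distrib, Finset.prod_mul_distrib,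
      Finset.prod_ite, Finset.prod_const, Finset.prod_const_one, mul_one, mul_comm θ,
      Real.exp_nat_mul]
    rfl
  simp only [key]
  have h2 : ∀ u : Fin k → Bool, _ := fun u => sum_fun_prod k (fun t b =>
    (bern p (f t) * bern s (u t) * bern s b *
        (if f t = true ∧ u t = true ∧ f (nx t) = true ∧ b = true then Real.exp θ else 1)))
  simp only [h2]
  rw [sum_fun_prod k (fun t c => ∑ b, (bern p (f t) * bern s c * bern s b *
        (if f t = true ∧ c = true ∧ f (nx t) = true ∧ b = true then Real.exp θ else 1)))]
  refine Finset.prod_congr rfl fun t _ => ?_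
  change _ = cycM p _ (f t) (f (nx t))
  cases f t <;> cases f (nx t) <;> simp [cycM, bern] <;> ring

/-- Lemma B.1 of the paper (identity case): the quadratic
`x² − (1 + ps²ν)x + p(1−p)s²ν`, `ν = e^θ − 1`, has two nonnegative real roots `μ₁ ≥ μ₂ ≥ 0`
and `E[exp(θ X_k)] = μ₁^k + μ₂^k`. -/
theorem cycle_exponential_moment
    (p s : ℝ) (hp : 0 < p) (hp1 : p < 1) (hs : 0 < s) (hs1 : s < 1)
    (k : ℕ) (hk : 1 ≤ k) (θ : ℝ) (hθ : 0 ≤ θ) :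
    ∃ μ₁ μ₂ : ℝ, 0 ≤ μ₂ ∧ μ₂ ≤ μ₁ ∧
      μ₁ ^ 2 - (1 + p * s ^ 2 * (Real.exp θ - 1)) * μ₁
        + p * (1 - p) * s ^ 2 * (Real.exp θ - 1) = 0 ∧
      μ₂ ^ 2 - (1 + p * s ^ 2 * (Real.exp θ - 1)) * μ₂
        + p * (1 - p) * s ^ 2 * (Real.exp θ - 1) = 0 ∧
      (∑ ω : CycOmega k, cycMass k p s ω * Real.exp (θ * (Xk k ω))) = μ₁ ^ k + μ₂ ^ k := by
  set ν := Real.exp θ - 1 with hν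
  have hν0 : 0 ≤ ν := by
    have := Real.add_one_le_exp θ
    linarith
  set a := p * s ^ 2 * ν with ha
  have ha0 : 0 ≤ a := by positivity
  have hD : p * (1 - p) * s ^ 2 * ν = (1 - p) * a := by rw [ha]; ring
  rw [hD]
  have hd : 0 ≤ (1 + a) ^ 2 - 4 * ((1 - p) * a) := by
    nlinarith [sq_nonneg (1 - a), mul_nonneg hp.le ha0]
  have hda : 0 ≤ (1 - p) * a := mul_nonneg (by linarith) ha0
  set r := Real.sqrt ((1 + a) ^ 2 - 4 * ((1 - p) * a)) with hr
  have hr0 : 0 ≤ r := Real.sqrt_nonneg _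
  have hr2 : r ^ 2 = (1 + a) ^ 2 - 4 * ((1 - p) * a) := Real.sq_sqrt hd
  have hra : r ≤ 1 + a := by
    apply Real.sqrt_le_iff.mpr
    constructor <;> linarith
  refine ⟨(1 + a + r) / 2, (1 + a - r) / 2, by linarith, by linarith, by nlinarith, by nlinarith, ?_⟩
  rw [moment_eq p s θ k hk]
  apply trace_pow
  · simp [Matrix.trace, cycM, bern, ha, hν]; ring
  · have : (1 + a + r) / 2 * ((1 + a - r) / 2) = (1 - p) * a := by nlinarith
    rw [this]
    simp [cycM, bern, ha, hν]; ring
end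
end

section
/- For every positive integer L there exists a constant C_L > 0 such that the following holds for every n ≥ 2. Let π* ∈ S_n, let V₀ ⊆ U ⊆ [n], set T = |U \ V₀|, and let π̃ : V₀ → [n] be an injection admitting at least one extension to an injection U → [n]. For an injection π̌ : U → [n] with π̌|_{V₀} = π̃, define the map φ : U → [n] by φ(j) = (π*)⁻¹(π̌(j)); say that i ∈ U lies in a complete cycle of length t (t ≥ 1) if φ^t(i) = i, the iterates φ(i), φ²(i), …, φ^{t−1}(i) all lie in U, and t is minimal with this property. For n_1, …, n_L ∈ ℕ, let S(n_1,…,n_L) be the set of injections π̌ : U → [n] with π̌|_{V₀} = π̃ such that for each 1 ≤ t ≤ L, exactly n_t vertices of U \ V₀ lie in complete cycles of length t. Then |S(n_1,…,n_L)| ≤ exp((T − n_1 − n_2/2 − ⋯ − n_L/L)·log n + C_L·n). -/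
open scoped Classical

noncomputable section

/-- The total extension of the map `φ = (π*)⁻¹ ∘ π̌ : U → [n]` to all of `[n]`
(identity off `U`); only its behaviour through points of `U` matters below. -/
def totalMap {n : ℕ} (πstar : Equiv.Perm (Fin n)) (U : Set (Fin n)) (g : U → Fin n)
    (x : Fin n) : Fin n :=
  if h : x ∈ U then πstar.symm (g ⟨x, h⟩) else x

/-- `i` lies in a complete cycle of length `t` for `φ`: `φ^t(i) = i`, the iterates
`φ(i), …, φ^{t−1}(i)` all lie in `U`, and `t` is minimal with this property. -/
def InCompleteCycleOfLen {n : ℕ} (φ : Fin n → Fin n) (U : Set (Fin n))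
    (i : Fin n) (t : ℕ) : Prop :=
  (φ^[t] i = i ∧ ∀ m : ℕ, 0 < m → m < t → φ^[m] i ∈ U) ∧
  ∀ t' : ℕ, 0 < t' → t' < t →
    ¬ (φ^[t'] i = i ∧ ∀ m : ℕ, 0 < m → m < t' → φ^[m] i ∈ U)

theorem cyc_period {n : ℕ} {φ : Fin n → Fin n} {U : Set (Fin n)} {i : Fin n} {t : ℕ}
    (ht : 0 < t) (hi : i ∈ U) :
    InCompleteCycleOfLen φ U i t ↔
      Function.minimalPeriod φ i = t ∧ ∀ m : ℕ, φ^[m] i ∈ U := by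
  constructor
  · rintro ⟨⟨h1, h2⟩, h3⟩
    have hp : Function.IsPeriodicPt φ t i := h1
    have hle := hp.minimalPeriod_le ht
    have hpos := hp.minimalPeriod_pos ht
    have hmp : Function.minimalPeriod φ i = t := by
      by_contra hne
      exact h3 _ hpos (lt_of_le_of_ne hle hne)
        ⟨Function.iterate_minimalPeriod, fun m hm hm' => h2 m hm (by omega)⟩
    refine ⟨hmp, fun m => ?_⟩
    rw [← Function.iterate_mod_minimalPeriod_eq, hmp]
    rcases Nat.eq_zero_or_pos (m % t) with h | h
    · rw [h]; exact hi
    · exact h2 _ h (Nat.mod_lt _ ht)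
  · rintro ⟨h1, h2⟩
    refine ⟨⟨?_, fun m _ _ => h2 m⟩, ?_⟩
    · rw [← h1]; exact Function.iterate_minimalPeriod
    · rintro t' h0 hlt ⟨h, -⟩
      have : Function.IsPeriodicPt φ t' i := h
      have := this.minimalPeriod_le h0
      omega

/-- The set of cycle representatives. -/
def reps {n : ℕ} (φ : Fin n → Fin n) (W U : Set (Fin n)) (L : ℕ) : Finset (Fin n) :=
  Finset.univ.filter fun i => i ∈ W ∧
    (Function.minimalPeriod φ i ∈ Finset.Icc 1 L ∧ ∀ m : ℕ, φ^[m] i ∈ U) ∧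
    ∀ m : ℕ, φ^[m] i ∈ W → i ≤ φ^[m] i

theorem reps_iter {n : ℕ} {φ : Fin n → Fin n} {W U : Set (Fin n)} {L : ℕ} {i : Fin n}
    (hi : i ∈ reps φ W U L) {m : ℕ} (h0 : 0 < m) (hm : m < Function.minimalPeriod φ i) :
    φ^[m] i ∉ reps φ W U L := by
  intro h
  simp only [reps, Finset.mem_filter, Finset.mem_univ, true_and] at hi h
  have h1 := hi.2.2 m h.1
  have e : φ^[Function.minimalPeriod φ i - m] (φ^[m] i) = i := by
    rw [← Function.iterate_add_apply, Nat.sub_add_cancel hm.le]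
    exact Function.iterate_minimalPeriod
  have h2 := h.2.2 (Function.minimalPeriod φ i - m) (by rw [e]; exact hi.1)
  rw [e] at h2
  have : Function.IsPeriodicPt φ m i := le_antisymm h2 h1
  have := this.minimalPeriod_le h0
  omega

theorem cyc_card {n : ℕ} (φ : Fin n → Fin n) {W U : Set (Fin n)} (hW : W ⊆ U) {L t : ℕ}
    (ht : t ∈ Finset.Icc 1 L) :
    ({i : Fin n | i ∈ W ∧ InCompleteCycleOfLen φ U i t}).ncard ≤
      t * ((reps φ W U L).filter fun i => Function.minimalPeriod φ i = t).card := by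
  have ht0 : 0 < t := by simp at ht; omega
  have hsub : {i : Fin n | i ∈ W ∧ InCompleteCycleOfLen φ U i t} ⊆
      ((((Finset.range t) ×ˢ ((reps φ W U L).filter
        fun i => Function.minimalPeriod φ i = t)).image fun p => φ^[p.1] p.2 :
          Finset (Fin n)) : Set (Fin n)) := by
    rintro i ⟨hi, hc⟩
    rw [cyc_period ht0 (hW hi)] at hc
    obtain ⟨hmp, hU⟩ := hc
    let O : Finset (Fin n) := Finset.univ.filter fun j => j ∈ W ∧ ∃ m : ℕ, φ^[m] i = j
    have hO : O.Nonempty := ⟨i, by simp only [O, Finset.mem_filter, Finset.mem_univ, true_and]; exact ⟨hi, 0, rfl⟩⟩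
    obtain ⟨r, hr, hmin⟩ := O.exists_min_image id hO
    simp only [O, Finset.mem_filter, Finset.mem_univ, true_and, id] at hr hmin
    obtain ⟨hrW, m, rfl⟩ := hr
    have hper : i ∈ Function.periodicPts φ :=
      Function.minimalPeriod_pos_iff_mem_periodicPts.1 (by omega)
    have hmpr : Function.minimalPeriod φ (φ^[m] i) = t := by
      rw [Function.minimalPeriod_apply_iterate hper, hmp]
    have hit : φ^[t] i = i := by rw [← hmp]; exact Function.iterate_minimalPeriod
    simp only [Finset.coe_image, Set.mem_image, Finset.mem_coe, Finset.mem_product,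
      Finset.mem_range, Finset.mem_filter, Prod.exists]
    refine ⟨(t * m - m) % t, φ^[m] i, ⟨Nat.mod_lt _ ht0, ?_, hmpr⟩, ?_⟩
    · simp only [reps, Finset.mem_filter, Finset.mem_univ, true_and]
      refine ⟨hrW, ⟨by rw [hmpr]; exact ht, fun k => ?_⟩, fun k hk => ?_⟩
      · rw [← Function.iterate_add_apply]; exact hU _
      · exact hmin _ ⟨hk, k + m, by rw [Function.iterate_add_apply]⟩
    · have h1 : m ≤ t * m := Nat.le_mul_of_pos_left _ ht0
      have h2 := Function.iterate_mod_minimalPeriod_eq (f := φ) (x := φ^[m] i) (n := t * m - m)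
      rw [hmpr] at h2
      rw [h2, ← Function.iterate_add_apply, Nat.sub_add_cancel h1]
      exact (show Function.IsPeriodicPt φ t i from hit).mul_const m
  calc _ ≤ _ := Set.ncard_le_ncard hsub
    _ ≤ _ := by
      rw [Set.ncard_coe_finset]
      refine Finset.card_image_le.trans ?_
      rw [Finset.card_product, Finset.card_range]

theorem reps_card {n : ℕ} (φ : Fin n → Fin n) {W U : Set (Fin n)} (hW : W ⊆ U) {L : ℕ} :
    (∑ t ∈ Finset.Icc 1 L,
      (({i : Fin n | i ∈ W ∧ InCompleteCycleOfLen φ U i t}).ncard : ℝ) / t) ≤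
      (reps φ W U L).card := by
  have h : (reps φ W U L).card = ∑ t ∈ Finset.Icc 1 L,
      ((reps φ W U L).filter fun i => Function.minimalPeriod φ i = t).card := by
    apply Finset.card_eq_sum_card_fiberwise
    intro i hi
    have hi' : i ∈ reps φ W U L := hi
    simp only [reps, Finset.mem_filter, Finset.mem_univ, true_and] at hi'
    exact hi'.2.1.1
  rw [h]
  push_cast
  refine Finset.sum_le_sum fun t ht => ?_
  have ht0 : 0 < t := by simp at ht; omega
  rw [div_le_iff₀ (by exact_mod_cast ht0), mul_comm]
  exact_mod_cast cyc_card φ hW ht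

theorem decode_le {n : ℕ} {φ ψ : Fin n → Fin n} {W U : Set (Fin n)} {L : ℕ}
    (hφ : Set.InjOn φ U) (hR : reps φ W U L = reps ψ W U L)
    (hag : ∀ x ∈ U, x ∉ reps φ W U L → φ x = ψ x) {v : Fin n} (hv : v ∈ reps φ W U L)
    (hle : Function.minimalPeriod φ v ≤ Function.minimalPeriod ψ v) : φ v = ψ v := by
  have hv' := hv
  rw [hR] at hv'
  have hv1 := hv
  have hv2 := hv'
  simp only [reps, Finset.mem_filter, Finset.mem_univ, true_and, Finset.mem_Icc] at hv1 hv2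
  obtain ⟨-, ⟨ht, hU⟩, -⟩ := hv1
  obtain ⟨-, ⟨ht', hU'⟩, -⟩ := hv2
  have hit : φ^[Function.minimalPeriod φ v] v = v := Function.iterate_minimalPeriod
  have hit' : ψ^[Function.minimalPeriod ψ v] v = v := Function.iterate_minimalPeriod
  have hn : ∀ m, 0 < m → m < Function.minimalPeriod φ v → φ^[m] v ∉ reps φ W U L :=
    fun m h0 hm => reps_iter hv h0 hm
  have hn' : ∀ m, 0 < m → m < Function.minimalPeriod ψ v → ψ^[m] v ∉ reps φ W U L :=
    fun m h0 hm => by rw [hR]; exact reps_iter hv' h0 hm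
  generalize Function.minimalPeriod φ v = t at *
  generalize Function.minimalPeriod ψ v = t' at *
  have key : ∀ k, k < t → φ^[t - k] v = ψ^[t' - k] v := by
    intro k
    induction k with
    | zero => intro _; simp [hit, hit']
    | succ k ih =>
      intro hk
      have h := ih (by omega)
      have e1 : t - k = (t - (k+1)) + 1 := by omega
      have e2 : t' - k = (t' - (k+1)) + 1 := by omega
      rw [e1, e2, Function.iterate_succ_apply', Function.iterate_succ_apply',
        ← hag _ (hU' _) (hn' _ (by omega) (by omega))] at h
      exact hφ (hU _) (hU' _) h
  have h := key (t - 1) (by omega)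
  have e1 : t - (t - 1) = 1 := by omega
  rw [e1, Function.iterate_one] at h
  rcases Nat.eq_or_lt_of_le hle with heq | hlt
  · have e2 : t' - (t - 1) = 1 := by omega
    rw [e2, Function.iterate_one] at h
    exact h
  · have e2 : t' - (t - 1) = (t' - t) + 1 := by omega
    rw [e2, Function.iterate_succ_apply',
      ← hag _ (hU' _) (hn' _ (by omega) (by omega))] at h
    have h3 := hφ (hU 0) (hU' _) h
    exact absurd hv (by
      have := hn' (t' - t) (by omega) (by omega)
      rw [← h3] at this
      exact this)

theorem decode {n : ℕ} {φ ψ : Fin n → Fin n} {W U : Set (Fin n)} {L : ℕ}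
    (hφ : Set.InjOn φ U) (hψ : Set.InjOn ψ U) (hR : reps φ W U L = reps ψ W U L)
    (hag : ∀ x ∈ U, x ∉ reps φ W U L → φ x = ψ x) : ∀ x ∈ U, φ x = ψ x := by
  intro x hx
  by_cases hv : x ∈ reps φ W U L
  · rcases le_total (Function.minimalPeriod φ x) (Function.minimalPeriod ψ x) with h | h
    · exact decode_le hφ hR hag hv h
    · refine (decode_le hψ hR.symm (fun y hy hy' => (hag y hy ?_).symm) (hR ▸ hv) h).symm
      rwa [hR]
  · exact hag x hx hv

theorem totalMap_injOn {n : ℕ} (πstar : Equiv.Perm (Fin n)) (U : Set (Fin n)) (g : U → Fin n)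
    (hg : Function.Injective g) : Set.InjOn (totalMap πstar U g) U := by
  intro x hx y hy h
  simp only [totalMap, hx, hy, dif_pos] at h
  exact congrArg Subtype.val (hg (πstar.symm.injective h))

/-- Lemma 2.8 of the paper: for each `L` there is `C_L > 0` such that for every `n ≥ 2`,
`π* ∈ S_n`, `V₀ ⊆ U ⊆ [n]` with `T = |U \ V₀|`, extendable partial matching `π̃` on `V₀`,
and profile `n_1, …, n_L`, the number of injections `π̌ : U → [n]` extending `π̃` with
exactly `n_t` vertices of `U \ V₀` in complete cycles of length `t` (for `1 ≤ t ≤ L`) is at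
most `exp((T − n_1 − n_2/2 − ⋯ − n_L/L)·log n + C_L·n)`. -/
theorem count_injections_with_cycle_profile (L : ℕ) (hL : 0 < L) :
    ∃ C_L : ℝ, 0 < C_L ∧
      ∀ n : ℕ, 2 ≤ n →
      ∀ (πstar : Equiv.Perm (Fin n)) (V₀ U : Set (Fin n)) (hVU : V₀ ⊆ U)
        (πt : V₀ → Fin n),
        (∃ ρ : U → Fin n, Function.Injective ρ ∧
          ∀ v : V₀, ρ ⟨v.1, hVU v.2⟩ = πt v) →
        ∀ nn : ℕ → ℕ,
          (({g : U → Fin n | Function.Injective g ∧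
              (∀ v : V₀, g ⟨v.1, hVU v.2⟩ = πt v) ∧
              ∀ t ∈ Finset.Icc 1 L,
                ({i : Fin n | i ∈ U \ V₀ ∧
                  InCompleteCycleOfLen (totalMap πstar U g) U i t}).ncard = nn t}).ncard : ℝ)
          ≤ Real.exp ((((U \ V₀).ncard : ℝ) - ∑ t ∈ Finset.Icc 1 L, (nn t : ℝ) / t)
              * Real.log n + C_L * n) := by
  refine ⟨Real.log 2, Real.log_pos (by norm_num), ?_⟩
  intro n hn πstar V₀ U hVU πt _ nn
  set S : Set (U → Fin n) := {g : U → Fin n | Function.Injective g ∧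
              (∀ v : V₀, g ⟨v.1, hVU v.2⟩ = πt v) ∧
              ∀ t ∈ Finset.Icc 1 L,
                ({i : Fin n | i ∈ U \ V₀ ∧
                  InCompleteCycleOfLen (totalMap πstar U g) U i t}).ncard = nn t} with hS
  let W : Set (Fin n) := U \ V₀
  have hW : W ⊆ U := Set.sdiff_subset
  let R : (U → Fin n) → Finset (Fin n) := fun g => reps (totalMap πstar U g) W U L
  have hRW : ∀ g, (R g : Set (Fin n)) ⊆ W := by
    intro g i hi
    have hi' : i ∈ reps (totalMap πstar U g) W U L := hi
    simp only [reps, Finset.mem_filter, Finset.mem_univ, true_and] at hi'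
    exact hi'.1
  set σ : ℝ := ∑ t ∈ Finset.Icc 1 L, (nn t : ℝ) / t with hσ
  have hRσ : ∀ g ∈ S, σ ≤ (R g).card := by
    intro g hg
    have h := reps_card (totalMap πstar U g) hW (L := L)
    refine le_trans (le_of_eq ?_) h
    refine Finset.sum_congr rfl fun t ht => ?_
    rw [← hg.2.2 t ht]
  have hn0 : (0 : ℝ) < n := by exact_mod_cast (by omega : 0 < n)
  have hn1 : (1 : ℝ) ≤ n := by exact_mod_cast (by omega : 1 ≤ n)
  have hlog : 0 ≤ Real.log n := Real.log_nonneg hn1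
  have hfib : ∀ Q : Finset (Fin n), (((S.toFinset.filter fun g => R g = Q).card : ℕ) : ℝ) ≤
      Real.exp (((W.ncard : ℝ) - σ) * Real.log n) := by
    intro Q
    rcases (S.toFinset.filter fun g => R g = Q).eq_empty_or_nonempty with h | ⟨g₀, hg₀⟩
    · rw [h]; simp only [Finset.card_empty, Nat.cast_zero]; positivity
    rw [Finset.mem_filter, Set.mem_toFinset] at hg₀
    have hQW : Q ⊆ W.toFinset := by
      intro i hi
      rw [Set.mem_toFinset]
      rw [← hg₀.2] at hi
      exact hRW g₀ hi
    have hQσ : σ ≤ Q.card := by rw [← hg₀.2]; exact hRσ _ hg₀.1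
    have hD : (W.toFinset \ Q).card + Q.card = W.ncard := by
      rw [Finset.card_sdiff_add_card_eq_card hQW, Set.ncard_eq_toFinset_card']
    have hcard : (S.toFinset.filter fun g => R g = Q).card ≤ n ^ (W.toFinset \ Q).card := by
      have hc : Fintype.card ((W.toFinset \ Q : Finset (Fin n)) → Fin n) =
          n ^ (W.toFinset \ Q).card := by
        rw [Fintype.card_fun, Fintype.card_fin, Fintype.card_coe]
      rw [← hc, ← Finset.card_univ]
      apply Finset.card_le_card_of_injOn
        (fun g (x : (W.toFinset \ Q : Finset (Fin n))) => totalMap πstar U g x.1)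
      · intro _ _; exact Finset.mem_coe.2 (Finset.mem_univ _)
      · intro g hg g' hg' h
        rw [Finset.mem_coe, Finset.mem_filter, Set.mem_toFinset] at hg hg'
        have hd := decode (W := W) (L := L) (totalMap_injOn πstar U g hg.1.1)
          (totalMap_injOn πstar U g' hg'.1.1) (hg.2.trans hg'.2.symm) (by
            intro x hx hxR
            by_cases hxV : x ∈ V₀
            · simp only [totalMap, hx, dif_pos]
              rw [hg.1.2.1 ⟨x, hxV⟩, hg'.1.2.1 ⟨x, hxV⟩]
            · have hxQ : x ∉ Q := by rw [← hg.2]; exact hxR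
              exact congrFun h ⟨x, by
                rw [Finset.mem_sdiff, Set.mem_toFinset]; exact ⟨⟨hx, hxV⟩, hxQ⟩⟩)
        funext ⟨x, hx⟩
        have := hd x hx
        simp only [totalMap, hx, dif_pos] at this
        exact πstar.symm.injective this
    calc (((S.toFinset.filter fun g => R g = Q).card : ℕ) : ℝ)
        ≤ ((n ^ (W.toFinset \ Q).card : ℕ) : ℝ) := by exact_mod_cast hcard
      _ = Real.exp (((W.toFinset \ Q).card : ℝ) * Real.log n) := by
          rw [Real.exp_nat_mul, Real.exp_log hn0]; push_cast; rfl
      _ ≤ _ := by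
          apply Real.exp_le_exp.2
          apply mul_le_mul_of_nonneg_right _ hlog
          have : ((W.toFinset \ Q).card : ℝ) + Q.card = W.ncard := by exact_mod_cast hD
          linarith
  have hsum : S.ncard = ∑ Q : Finset (Fin n), (S.toFinset.filter fun g => R g = Q).card := by
    rw [Set.ncard_eq_toFinset_card']
    exact Finset.card_eq_sum_card_fiberwise (fun _ _ => Finset.mem_coe.2 (Finset.mem_univ _))
  rw [hsum]
  push_cast
  refine (Finset.sum_le_sum fun Q _ => hfib Q).trans ?_
  rw [Finset.sum_const, Finset.card_univ, Fintype.card_finset, Fintype.card_fin, nsmul_eq_mul,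
    Real.exp_add, mul_comm (Real.log 2), Real.exp_nat_mul, Real.exp_log (by norm_num)]
  push_cast
  exact le_of_eq (mul_comm _ _)
end
end
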